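/- arXiv:0903.1453 — 2 statements merged into one kernel-verified Lean document; each statement's English description precedes it below -/
import Mathlib

section
/- In the Z_2-vector space freely generated by noncrossing perfect matchings (chord diagrams) of n chords modulo the bypass relation, the classes of the basis chord diagrams Γ_w for w ∈ W(n_-, n_+) (constructed by the base point construction algorithm) are linearly independent and span the euler class e = n_+ - n_- summand; hence this summand has dimension C(n-1, n_+) where n-1 = n_- + n_+. -/
/-- Positions (0-indexed, left to right) of the minus signs (`false`) in a word. -/
def minusPos (w : List Bool) : List ℕ :=
  (List.range w.length).filter (fun i => w.getD i true = false)

/-- `w ∈ W(n₋, n₊)`: the word has `n₋` minus signs and `n₊` plus signs. -/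
def memW (nm np : ℕ) (w : List Bool) : Prop :=
  w.count false = nm ∧ w.count true = np

/-- The partial order `⪯`: the i'th minus sign of `w₀` occurs at a position
less than or equal to the position of the i'th minus sign of `w₁`. -/
def wle (w₀ w₁ : List Bool) : Prop :=
  ∀ i, (minusPos w₀).getD i 0 ≤ (minusPos w₁).getD i 0


/-- A chord diagram with `n` chords, encoded as a fixed-point-free involution
of the `2n` marked points `0, …, 2n-1` (normalized to be the identity
elsewhere). -/
def IsMatching (n : ℕ) (f : ℕ → ℕ) : Prop :=
  (∀ i, i < 2*n → f i < 2*n) ∧ (∀ i, i < 2*n → f (f i) = i) ∧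
  (∀ i, i < 2*n → f i ≠ i) ∧ (∀ i, ¬ i < 2*n → f i = i)

/-- The matching is noncrossing: there are no chords `{a, f a}`, `{b, f b}`
with `a < b < f a < f b`. -/
def Noncrossing (n : ℕ) (f : ℕ → ℕ) : Prop :=
  ∀ a b, a < 2*n → b < 2*n → ¬ (a < b ∧ b < f a ∧ f a < f b)

/-- A chord diagram of `n` chords: a noncrossing perfect matching of the `2n`
marked points, with base point `0`. -/
def IsCD (n : ℕ) (f : ℕ → ℕ) : Prop := IsMatching n f ∧ Noncrossing n f


/-- The relative euler class of a chord diagram: the signed count of regions.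
Each chord `{a, f a}` with `a < f a` contributes the sign of the region just
inside it (+1 if `a` is even, -1 if odd), and the outer region (adjacent to
the arc just anticlockwise of the base point) contributes `-1`. -/
def eulerClass (n : ℕ) (f : ℕ → ℕ) : ℤ :=
  -1 + ∑ i ∈ Finset.range (2*n),
    (if i < f i then (if Even i then (1 : ℤ) else -1) else 0)


/-- Three chord diagrams form a bypass triple: they agree away from six marked
points `q 0 < q 1 < … < q 5`, on which they induce the three noncrossing
matchings related by 60° rotation. -/
def BypassRel (n : ℕ) (f g h : ℕ → ℕ) : Prop :=
  IsCD n f ∧ IsCD n g ∧ IsCD n h ∧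
  ∃ q : Fin 6 → ℕ, StrictMono q ∧ (∀ j, q j < 2*n) ∧
    (∀ i, i < 2*n → (∀ j, i ≠ q j) → f i = g i ∧ f i = h i) ∧
    f (q 0) = q 5 ∧ f (q 1) = q 4 ∧ f (q 2) = q 3 ∧
    g (q 0) = q 1 ∧ g (q 2) = q 5 ∧ g (q 3) = q 4 ∧
    h (q 0) = q 3 ∧ h (q 1) = q 2 ∧ h (q 4) = q 5

/-- The submodule of relations in the free `ℤ/2`-vector space on functions
`ℕ → ℕ`: bypass triples sum to zero, and anything that is not a chord diagram
of `n` chords is zero.  The quotient is the combinatorial `SFH(T,n)`. -/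
noncomputable def bypassSub (n : ℕ) : Submodule (ZMod 2) ((ℕ → ℕ) →₀ ZMod 2) :=
  Submodule.span (ZMod 2)
    ({x | ∃ f g h, BypassRel n f g h ∧
        x = Finsupp.single f 1 + Finsupp.single g 1 + Finsupp.single h 1} ∪
     {x | ∃ f, ¬ IsCD n f ∧ x = Finsupp.single f (1 : ZMod 2)})


/-- The chord drawn at step `p` of the base point construction algorithm for
the word `w`, as a pair of labels in `ℤ` (taken mod `2|w|+2`, base point `0`). -/
def chordAt (w : List Bool) (p : ℕ) : ℤ × ℤ :=
  let im : ℤ := ((w.take p).count false : ℤ)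
  let ip : ℤ := ((w.take p).count true : ℤ)
  if w.getD p true = false then
    if p = 0 ∨ w.getD (p-1) true ≠ w.getD p true then
      (1 - 2*(im+1), 2*ip)
    else (1 - 2*(im+1), 2 - 2*(im+1))
  else
    if p = 0 ∨ w.getD (p-1) true ≠ w.getD p true then
      (-2*im, 2*(ip+1) - 1)
    else (2*(ip+1) - 2, 2*(ip+1) - 1)

/-- Reduce an integer label to a marked point in `{0, …, 2m+1}`. -/
def toPt (m : ℕ) (x : ℤ) : ℕ := (x % (2*(m:ℤ)+2)).toNat

/-- The final chord of the base point construction algorithm, joining the two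
remaining marked points; it has an endpoint at the root point `2n₊ + 1`. -/
def finalChord (w : List Bool) : ℕ × ℕ :=
  match w.getLast? with
  | some false => (toPt w.length (2*(w.count true : ℤ) + 1),
                   toPt w.length (2*(w.count true : ℤ) + 2))
  | some true  => (toPt w.length (2*(w.count true : ℤ)),
                   toPt w.length (2*(w.count true : ℤ) + 1))
  | none => (0, 1)

/-- The list of chords of the basis chord diagram `Γ_w` (with `|w|+1` chords):
the chords produced by the base point construction algorithm, together with
the final chord at the root point. -/
def gammaPairs (w : List Bool) : List (ℕ × ℕ) :=
  ((List.range w.length).map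
    (fun p => (toPt w.length (chordAt w p).1, toPt w.length (chordAt w p).2)))
  ++ [finalChord w]

/-- The basis chord diagram `Γ_w`, as a matching function on the
`2|w|+2` marked points. -/
def gammaWord (w : List Bool) : ℕ → ℕ := fun a =>
  match (gammaPairs w).find? (fun pr => pr.1 == a || pr.2 == a) with
  | some pr => if pr.1 = a then pr.2 else pr.1
  | none => a



namespace CDx

def sg (n j : ℕ) : ℕ := if j = 0 then 0 else 2*n - j
def S (n : ℕ) (f : ℕ → ℕ) : ℕ → ℕ := fun j => if j < 2*n then sg n (f (sg n j)) else j
def M (n : ℕ) (f : ℕ → ℕ) : ℕ → ℕ := fun j => if j < 2*n then 2*n - 1 - f (2*n - 1 - j) else j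
def P (f : ℕ → ℕ) : ℕ → ℕ := fun j => if j = 0 then 1 else if j = 1 then 0 else f (j-2) + 2
def C (f : ℕ → ℕ) : ℕ → ℕ := fun j =>
  if f (j+2) = 0 then f 1 - 2 else if f (j+2) = 1 then f 0 - 2 else f (j+2) - 2

theorem S_cd {n : ℕ} {f : ℕ → ℕ} (hf : IsCD n f) : IsCD n (S n f) := by
  obtain ⟨⟨h1, h2, h3, h4⟩, h5⟩ := hf
  refine ⟨⟨?_, ?_, ?_, ?_⟩, ?_⟩
  · intro i hi; simp only [S, sg]; grind
  · intro i hi; simp only [S, sg]; grind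
  · intro i hi; simp only [S, sg]; grind
  · intro i hi; simp only [S, sg]; grind
  · rintro a b ha hb ⟨k1, k2, k3⟩
    have hb0 : b ≠ 0 := by omega
    simp only [S, sg, if_pos ha, if_pos hb, if_neg hb0] at k2 k3
    have e1 := h1 (2*n-b) (by omega)
    have e2 := h2 (2*n-b) (by omega)
    by_cases ha0 : a = 0
    · subst ha0
      simp only [if_true] at k2 k3
      have e0 := h1 0 ha
      have := h5 (f (2*n-b)) (f 0)
      have := h5 0 (f (2*n-b))
      grind
    · simp only [if_neg ha0] at k2 k3
      have f1 := h1 (2*n-a) (by omega)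
      have f2 := h2 (2*n-a) (by omega)
      have := h5 (f (2*n-b)) (f (2*n-a))
      grind

theorem M_cd {n : ℕ} {f : ℕ → ℕ} (hf : IsCD n f) : IsCD n (M n f) := by
  obtain ⟨⟨h1, h2, h3, h4⟩, h5⟩ := hf
  refine ⟨⟨?_, ?_, ?_, ?_⟩, ?_⟩
  · intro i hi; simp only [M]; grind
  · intro i hi
    have := h1 (2*n-1-i) (by omega)
    have := h2 (2*n-1-i) (by omega)
    have e : 2*n-1-(2*n-1-f (2*n-1-i)) = f (2*n-1-i) := by omega
    have l : 2*n-1-f (2*n-1-i) < 2*n := by omega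
    simp only [M, if_pos hi, if_pos l, e]; omega
  · intro i hi
    have := h1 (2*n-1-i) (by omega)
    have := h3 (2*n-1-i) (by omega)
    simp only [M, if_pos hi]; omega
  · intro i hi; simp only [M]; grind
  · rintro a b ha hb ⟨k1, k2, k3⟩
    simp only [M, if_pos ha, if_pos hb] at k2 k3
    have e1 := h1 (2*n-1-b) (by omega)
    have e2 := h2 (2*n-1-b) (by omega)
    have f1 := h1 (2*n-1-a) (by omega)
    have f2 := h2 (2*n-1-a) (by omega)
    have := h5 (f (2*n-1-b)) (f (2*n-1-a))
    rw [e2, f2] at this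
    omega

theorem P_cd {n : ℕ} {f : ℕ → ℕ} (hf : IsCD n f) : IsCD (n+1) (P f) := by
  obtain ⟨⟨h1, h2, h3, h4⟩, h5⟩ := hf
  refine ⟨⟨?_, ?_, ?_, ?_⟩, ?_⟩
  · intro i hi; simp only [P]; have := h1 (i-2); split_ifs <;> omega
  · intro i hi; simp only [P]; have := h2 (i-2); grind
  · intro i hi; simp only [P]; have := h3 (i-2); grind
  · intro i hi; simp only [P]; have := h4 (i-2); grind
  · rintro a b ha hb ⟨k1, k2, k3⟩
    simp only [P] at k2 k3
    have := h5 (a-2) (b-2)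
    grind

theorem C_cd {n : ℕ} {f : ℕ → ℕ} (hf : IsCD (n+1) f) : IsCD n (C f) := by
  obtain ⟨⟨h1, h2, h3, h4⟩, h5⟩ := hf
  have a0 := h1 0 (by omega)
  have a1 := h1 1 (by omega)
  have b0 := h2 0 (by omega)
  have b1 := h2 1 (by omega)
  have c0 := h3 0 (by omega)
  have c1 := h3 1 (by omega)
  have d := h5 0 1 (by omega) (by omega)
  refine ⟨⟨?_, ?_, ?_, ?_⟩, ?_⟩
  · intro i hi; simp only [C]; have := h1 (i+2); have := h2 (i+2); grind
  · intro i hi; simp only [C]; have := h1 (i+2); have := h2 (i+2); have := h3 (i+2)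
    by_cases e0 : f (i+2) = 0
    · simp only [if_pos e0]
      have : f 1 - 2 + 2 = f 1 := by grind
      rw [this]; grind
    · by_cases e1 : f (i+2) = 1
      · simp only [if_neg e0, if_pos e1]
        have : f 0 - 2 + 2 = f 0 := by grind
        rw [this]; grind
      · simp only [if_neg e0, if_neg e1]
        have : f (i+2) - 2 + 2 = f (i+2) := by omega
        rw [this]; grind
  · intro i hi; simp only [C]; have := h1 (i+2); have := h2 (i+2); have := h3 (i+2); grind
  · intro i hi; simp only [C]; have := h4 (i+2); grind
  · rintro a b ha hb ⟨k1, k2, k3⟩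
    simp only [C] at k2 k3
    have := h5 (a+2) (b+2) (by omega) (by omega)
    have := h5 0 (b+2) (by omega) (by omega)
    have := h5 1 (a+2) (by omega) (by omega)
    have := h2 (a+2) (by omega)
    have := h2 (b+2) (by omega)
    grind

theorem S_S {n : ℕ} {f : ℕ → ℕ} (hf : IsCD n f) : S n (S n f) = f := by
  obtain ⟨⟨h1, h2, h3, h4⟩, h5⟩ := hf
  funext j
  by_cases hj : j < 2*n
  · have : sg n (sg n j) = j := by simp only [sg]; grind
    have l : sg n j < 2*n := by simp only [sg]; grind
    have l2 := h1 j hj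
    simp only [S, if_pos hj, if_pos l, this]
    simp only [sg]; grind
  · simp only [S, if_neg hj]; exact (h4 j hj).symm

theorem M_M {n : ℕ} {f : ℕ → ℕ} (hf : IsCD n f) : M n (M n f) = f := by
  obtain ⟨⟨h1, h2, h3, h4⟩, h5⟩ := hf
  funext j
  by_cases hj : j < 2*n
  · have : 2*n-1-(2*n-1-j) = j := by omega
    have l : 2*n-1-j < 2*n := by omega
    have l2 := h1 j hj
    simp only [M, if_pos hj, if_pos l, this]
    omega
  · simp only [M, if_neg hj]; exact (h4 j hj).symm

theorem C_S_P {n : ℕ} {f : ℕ → ℕ} (hn : 0 < n) (hf : IsCD n f) :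
    C (S (n+1) (P f)) = M n (S n (M n f)) := by
  obtain ⟨⟨h1, h2, h3, h4⟩, h5⟩ := hf
  have e0 : S (n+1) (P f) 0 = 2*n+1 := by simp [S, sg, P]; omega
  have e1 : S (n+1) (P f) 1 = 2*n - f (2*n-1) := by
    have : f (2*(n+1)-1-2) = f (2*n-1) := by congr 1
    simp only [S, sg, P]; grind
  have e2 : ∀ k, k + 2 ≤ 2 * n → S (n+1) (P f) (k+2) = 2*n - f (2*n-2-k) := by
    intro k hk
    have : f (2*(n+1)-(k+2)-2) = f (2*n-2-k) := by congr 1; omega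
    simp only [S, sg, P]; grind
  have e3 : S (n+1) (P f) (2*n-1+2) = 0 := by
    have : 2*n-1+2 = 2*n+1 := by omega
    rw [this]
    simp only [S, sg, P]; grind
  have e5 : ∀ k, ¬ k < 2*n → S (n+1) (P f) (k+2) = k+2 := by
    intro k hk
    simp only [S]; grind
  have g0 : ∀ k, k + 2 ≤ 2 * n → M n (S n (M n f)) k =
      if f (2*n-2-k) = 2*n-1 then 2*n-1 else 2*n-1 - (f (2*n-2-k) + 1) := by
    intro k hk
    have l1 := h1 (2*n-2-k) (by omega)
    have e4 : 2*n-1-(2*n-(2*n-1-k)) = 2*n-2-k := by omega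
    have l2 : 2 * n - (2 * n - 1 - k) < 2*n := by omega
    have l3 : 2*n-1-k < 2*n := by omega
    have l4 : ¬ (2 * n - 1 - k = 0) := by omega
    have l5 : k < 2*n := by omega
    simp only [M, S, sg, if_pos l5, if_neg l4, if_pos l2, if_pos l3, e4]
    generalize f (2*n-2-k) = x at *
    split_ifs <;> omega
  have g1 : M n (S n (M n f)) (2*n-1) =
      if f (2*n-1) = 2*n-1 then 2*n-1 else 2*n-1 - (f (2*n-1) + 1) := by
    have l1 := h1 (2*n-1) (by omega)
    have l5 : 2*n-1 < 2*n := by omega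
    have l6 : 0 < 2*n := by omega
    have l7 : 2*n-1-0 = 2*n-1 := by omega
    simp only [M, S, sg, if_pos l5, if_pos l6, l7, Nat.sub_self, if_true]
    generalize f (2*n-1) = x at *
    split_ifs <;> omega
  funext j
  by_cases hj : j < 2*n
  · by_cases hj' : j = 2*n-1
    · subst hj'
      have l1 := h1 (2*n-1) (by omega)
      have l2 := h3 (2*n-1) (by omega)
      rw [g1]; unfold C; rw [e3, e1]
      generalize f (2*n-1) = x at *
      split_ifs <;> omega
    · have l1 := h1 (2*n-2-j) (by omega)
      rw [g0 j (by omega)]; unfold C; rw [e2 j (by omega), e1, e0]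
      generalize f (2*n-2-j) = x at *
      split_ifs <;> omega
  · unfold C
    rw [e5 j hj]
    rw [if_neg (by omega), if_neg (by omega)]
    simp only [M, if_neg hj]
    omega

theorem P_C {n : ℕ} {f : ℕ → ℕ} (hf : IsCD (n+1) f) (h : f 0 = 1) : P (C f) = f := by
  obtain ⟨⟨h1, h2, h3, h4⟩, h5⟩ := hf
  have b0 := h2 0 (by omega)
  funext j
  simp only [P, C]
  split_ifs with i1 i2 i3 i4
  · grind
  · grind
  · have := h2 j; have := h4 j; grind
  · have := h2 j; have := h4 j; grind
  · have := h2 j; have := h4 j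
    have e : j - 2 + 2 = j := by omega
    rw [e] at i3 i4 ⊢; omega
end CDx


namespace CDx

def BP (n : ℕ) (f g h : ℕ → ℕ) (a0 a1 a2 a3 a4 a5 : ℕ) : Prop :=
  a0 < a1 ∧ a1 < a2 ∧ a2 < a3 ∧ a3 < a4 ∧ a4 < a5 ∧ a5 < 2*n ∧
  (∀ i, i < 2*n → i ≠ a0 → i ≠ a1 → i ≠ a2 → i ≠ a3 → i ≠ a4 → i ≠ a5 → f i = g i ∧ f i = h i) ∧
    f a0 = a5 ∧ f a1 = a4 ∧ f a2 = a3 ∧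
    g a0 = a1 ∧ g a2 = a5 ∧ g a3 = a4 ∧
    h a0 = a3 ∧ h a1 = a2 ∧ h a4 = a5

theorem bp_iff {n : ℕ} {f g h : ℕ → ℕ} (hf : IsCD n f) (hg : IsCD n g) (hh : IsCD n h) :
    BypassRel n f g h ↔ ∃ a0 a1 a2 a3 a4 a5, BP n f g h a0 a1 a2 a3 a4 a5 := by
  constructor
  · rintro ⟨_, _, _, q, hq, hlt, hag, r⟩
    refine ⟨q 0, q 1, q 2, q 3, q 4, q 5, hq (by decide), hq (by decide), hq (by decide),
      hq (by decide), hq (by decide), hlt 5, ?_, r⟩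
    intro i hi h0 h1 h2 h3 h4 h5
    apply hag i hi
    intro j
    fin_cases j <;> assumption
  · rintro ⟨a0, a1, a2, a3, a4, a5, h0, h1, h2, h3, h4, h5, hag, r⟩
    refine ⟨hf, hg, hh, ![a0, a1, a2, a3, a4, a5], ?_, ?_, ?_, r⟩
    · rw [Fin.strictMono_iff_lt_succ]
      intro i
      fin_cases i <;> simpa
    · intro j
      fin_cases j <;> simp <;> omega
    · intro i hi hj
      exact hag i hi (hj 0) (hj 1) (hj 2) (hj 3) (hj 4) (hj 5)

theorem cd_lt {n : ℕ} {f : ℕ → ℕ} (hf : IsCD n f) {i : ℕ} (hi : i < 2*n) : f i < 2*n := hf.1.1 i hi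
theorem cd_inv {n : ℕ} {f : ℕ → ℕ} (hf : IsCD n f) {i j : ℕ} (hi : i < 2*n) (h : f i = j) : f j = i := by
  rw [← h]; exact hf.1.2.1 i hi
theorem cd_ne {n : ℕ} {f : ℕ → ℕ} (hf : IsCD n f) {i : ℕ} (hi : i < 2*n) : f i ≠ i := hf.1.2.2.1 i hi

theorem P_bp {n : ℕ} {f g h : ℕ → ℕ} (hb : BypassRel n f g h) :
    BypassRel (n+1) (P f) (P g) (P h) := by
  have hf := hb.1
  have hg := hb.2.1
  have hh := hb.2.2.1
  rw [bp_iff hf hg hh] at hb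
  rw [bp_iff (P_cd hf) (P_cd hg) (P_cd hh)]
  obtain ⟨a0, a1, a2, a3, a4, a5, h0, h1, h2, h3, h4, h5, hag, r1, r2, r3, r4, r5, r6, r7, r8, r9⟩ := hb
  refine ⟨a0+2, a1+2, a2+2, a3+2, a4+2, a5+2, by omega, by omega, by omega, by omega, by omega, by omega, ?_, ?_⟩
  · intro i hi k0 k1 k2 k3 k4 k5
    have := hag (i-2)
    simp only [P]
    grind
  · simp [P, *]

theorem M_val {n : ℕ} {f : ℕ → ℕ} {i j : ℕ} (hi : i < 2*n) (h : f i = j) :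
    M n f (2*n-1-i) = 2*n-1-j := by
  have : 2*n-1-(2*n-1-i) = i := by omega
  have l : 2*n-1-i < 2*n := by omega
  simp only [M, this, if_pos l, h]

theorem M_bp {n : ℕ} {f g h : ℕ → ℕ} (hb : BypassRel n f g h) :
    BypassRel n (M n f) (M n h) (M n g) := by
  have hf := hb.1
  have hg := hb.2.1
  have hh := hb.2.2.1
  rw [bp_iff hf hg hh] at hb
  rw [bp_iff (M_cd hf) (M_cd hh) (M_cd hg)]
  obtain ⟨a0, a1, a2, a3, a4, a5, h0, h1, h2, h3, h4, h5, hag, r1, r2, r3, r4, r5, r6, r7, r8, r9⟩ := hb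
  refine ⟨2*n-1-a5, 2*n-1-a4, 2*n-1-a3, 2*n-1-a2, 2*n-1-a1, 2*n-1-a0, by omega, by omega, by omega, by omega, by omega, by omega, ?_, ?_, ?_, ?_, ?_, ?_, ?_, ?_, ?_, ?_⟩
  · intro i hi k0 k1 k2 k3 k4 k5
    have := hag (2*n-1-i) (by omega) (by omega) (by omega) (by omega) (by omega) (by omega) (by omega)
    simp only [M, if_pos hi]
    omega
  all_goals first
    | exact M_val (by omega) (cd_inv hf (by omega) (by assumption))
    | exact M_val (by omega) (cd_inv hg (by omega) (by assumption))
    | exact M_val (by omega) (cd_inv hh (by omega) (by assumption))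

theorem S_val {n : ℕ} {f : ℕ → ℕ} {i j : ℕ} (hi : i < 2*n) (hi0 : i ≠ 0) (hj0 : j ≠ 0) (h : f i = j) :
    S n f (2*n-i) = 2*n-j := by
  have : 2*n-(2*n-i) = i := by omega
  have l : 2*n-i < 2*n := by omega
  have l2 : 2*n-i ≠ 0 := by omega
  simp only [S, sg, if_pos l, if_neg l2, this, h, if_neg hj0]

theorem S_val0 {n : ℕ} {f : ℕ → ℕ} {j : ℕ} (hi : 0 < 2*n) (hj0 : j ≠ 0) (h : f 0 = j) :
    S n f 0 = 2*n-j := by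
  simp only [S, sg, if_pos hi, if_true, h, if_neg hj0]

theorem S_bp {n : ℕ} {f g h : ℕ → ℕ} (hb : BypassRel n f g h) :
    BypassRel n (S n f) (S n h) (S n g) ∨ BypassRel n (S n g) (S n f) (S n h) := by
  have hf := hb.1
  have hg := hb.2.1
  have hh := hb.2.2.1
  rw [bp_iff hf hg hh] at hb
  obtain ⟨a0, a1, a2, a3, a4, a5, h0, h1, h2, h3, h4, h5, hag, r1, r2, r3, r4, r5, r6, r7, r8, r9⟩ := hb
  by_cases ha : a0 = 0
  · right
    rw [bp_iff (S_cd hg) (S_cd hf) (S_cd hh)]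
    subst ha
    refine ⟨0, 2*n-a5, 2*n-a4, 2*n-a3, 2*n-a2, 2*n-a1, by omega, by omega, by omega, by omega, by omega, by omega, ?_, ?_, ?_, ?_, ?_, ?_, ?_, ?_, ?_, ?_⟩
    · intro i hi k0 k1 k2 k3 k4 k5
      have := hag (2*n-i) (by omega) (by omega) (by omega) (by omega) (by omega) (by omega) (by omega)
      simp only [S, sg, if_pos hi, if_neg k0, ← this.1, ← this.2, and_self]
    all_goals first
      | exact S_val0 (by omega) (by omega) (by assumption)
      | exact S_val (by omega) (by omega) (by omega) (cd_inv hf (by omega) (by assumption))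
      | exact S_val (by omega) (by omega) (by omega) (cd_inv hg (by omega) (by assumption))
      | exact S_val (by omega) (by omega) (by omega) (cd_inv hh (by omega) (by assumption))
  · left
    rw [bp_iff (S_cd hf) (S_cd hh) (S_cd hg)]
    refine ⟨2*n-a5, 2*n-a4, 2*n-a3, 2*n-a2, 2*n-a1, 2*n-a0, by omega, by omega, by omega, by omega, by omega, by omega, ?_, ?_, ?_, ?_, ?_, ?_, ?_, ?_, ?_, ?_⟩
    · intro i hi k0 k1 k2 k3 k4 k5
      by_cases hi0 : i = 0
      · have := hag 0 (by omega) (by omega) (by omega) (by omega) (by omega) (by omega) (by omega)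
        simp only [S, sg, if_pos hi, if_pos hi0, ← this.1, ← this.2, and_self]
      have := hag (2*n-i) (by omega) (by omega) (by omega) (by omega) (by omega) (by omega) (by omega)
      simp only [S, sg, if_pos hi, if_neg hi0, ← this.1, ← this.2, and_self]
    all_goals first
      | exact S_val (by omega) (by omega) (by omega) (cd_inv hf (by omega) (by assumption))
      | exact S_val (by omega) (by omega) (by omega) (cd_inv hg (by omega) (by assumption))
      | exact S_val (by omega) (by omega) (by omega) (cd_inv hh (by omega) (by assumption))

theorem C_val {f : ℕ → ℕ} {i j : ℕ} (hi : 2 ≤ i) (hj : 2 ≤ j) (h : f i = j) :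
    C f (i-2) = j-2 := by
  have : i-2+2 = i := by omega
  simp only [C, this, h]
  rw [if_neg (by omega), if_neg (by omega)]

theorem C_val0 {f : ℕ → ℕ} {i v : ℕ} (hi : 2 ≤ i) (h : f i = 0) (h1 : f 1 = v) :
    C f (i-2) = v-2 := by
  have : i-2+2 = i := by omega
  simp only [C, this, h, h1, if_true]

theorem C_val1 {f : ℕ → ℕ} {i v : ℕ} (hi : 2 ≤ i) (h : f i = 1) (h1 : f 0 = v) :
    C f (i-2) = v-2 := by
  have : i-2+2 = i := by omega
  simp only [C, this, h, h1, if_true]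
  rfl

/-- the four possible outcomes of capping off a bypass triple -/
theorem C_bp {n : ℕ} {f g h : ℕ → ℕ} (hb : BypassRel (n+1) f g h) :
    (f 0 = 1 ∧ g 0 = 1 ∧ h 0 = 1) ∨
    (f 0 ≠ 1 ∧ g 0 ≠ 1 ∧ h 0 ≠ 1 ∧ BypassRel n (C f) (C g) (C h)) ∨
    (f 0 ≠ 1 ∧ g 0 ≠ 1 ∧ h 0 ≠ 1 ∧ BypassRel n (C g) (C h) (C f)) ∨
    (f 0 ≠ 1 ∧ g 0 = 1 ∧ h 0 ≠ 1 ∧ C f = C h) := by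
  have hf := hb.1
  have hg := hb.2.1
  have hh := hb.2.2.1
  rw [bp_iff hf hg hh] at hb
  obtain ⟨a0, a1, a2, a3, a4, a5, h0, h1, h2, h3, h4, h5, hag, r1, r2, r3, r4, r5, r6, r7, r8, r9⟩ := hb
  have r1' := cd_inv hf (by omega) r1
  have r2' := cd_inv hf (by omega) r2
  have r3' := cd_inv hf (by omega) r3
  have r4' := cd_inv hg (by omega) r4
  have r5' := cd_inv hg (by omega) r5
  have r6' := cd_inv hg (by omega) r6
  have r7' := cd_inv hh (by omega) r7
  have r8' := cd_inv hh (by omega) r8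
  have r9' := cd_inv hh (by omega) r9
  by_cases ha : a0 = 0
  · subst ha
    by_cases hb : a1 = 1
    · -- double
      subst hb
      right; right; right
      refine ⟨by omega, by omega, by omega, ?_⟩
      funext i
      by_cases hi : i + 2 < 2*(n+1)
      · by_cases k2 : i + 2 = a2
        · simp only [C, k2, r3, r8']
          rw [if_neg (by omega), if_neg (by omega)]; simp [r7]
        by_cases k3 : i + 2 = a3
        · simp only [C, k3, r3', r7']
          rw [if_neg (by omega), if_neg (by omega)]; simp [r8]
        by_cases k4 : i + 2 = a4
        · simp only [C, k4, r2', r9]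
          simp; rw [if_neg (by omega), if_neg (by omega), r1]
        by_cases k5 : i + 2 = a5
        · simp only [C, k5, r1', r9']
          simp; rw [if_neg (by omega), if_neg (by omega), r2]
        have := hag (i+2) hi (by omega) (by omega) k2 k3 k4 k5
        have b0 : f (i+2) ≠ 0 := by
          intro hh; have := cd_inv hf hi hh; omega
        have b1 : f (i+2) ≠ 1 := by
          intro hh; have := cd_inv hf hi hh; omega
        simp only [C, ← this.2]
        rw [if_neg b0, if_neg b1, if_neg b0, if_neg b1]
      · have e1 := hf.1.2.2.2 _ hi
        have e2 := hh.1.2.2.2 _ hi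
        simp [C, e1, e2]
    · -- 0 in, 1 out
      right; left
      have e := hag 1 (by omega) (by omega) (by omega) (by omega) (by omega) (by omega) (by omega)
      obtain ⟨x, hx⟩ : ∃ x, f 1 = x := ⟨_, rfl⟩
      have hxg : g 1 = x := by omega
      have hxh : h 1 = x := by omega
      have hx' := cd_inv hf (by omega) hx
      have hxg' := cd_inv hg (by omega) hxg
      have hxh' := cd_inv hh (by omega) hxh
      have x1 := cd_lt hf (i := 1) (by omega)
      have x2 := cd_ne hf (i := 1) (by omega)
      have hx2 : 2 ≤ x := by
        rcases Nat.lt_or_ge x 2 with h | h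
        · interval_cases x
          · omega
          · omega
        · exact h
      have hxa : x < a1 := by
        have := hg.2 0 1 (by omega) (by omega)
        have : x ≠ a1 := by rintro rfl; omega
        omega
      refine ⟨by omega, by omega, by omega, ?_⟩
      rw [bp_iff (C_cd hf) (C_cd hg) (C_cd hh)]
      refine ⟨x-2, a1-2, a2-2, a3-2, a4-2, a5-2, by omega, by omega, by omega, by omega, by omega, by omega, ?_, ?_, ?_, ?_, ?_, ?_, ?_, ?_, ?_, ?_⟩
      · intro i hi k0 k1 k2 k3 k4 k5
        have := hag (i+2) (by omega) (by omega) (by omega) (by omega) (by omega) (by omega) (by omega)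
        have b0 : f (i+2) ≠ 0 := by
          intro hh; have := cd_inv hf (by omega) hh; omega
        have b1 : f (i+2) ≠ 1 := by
          intro hh; have := cd_inv hf (by omega) hh; omega
        simp only [C, ← this.1, ← this.2]
        rw [if_neg b0, if_neg b1, if_neg b0, if_neg b1, if_neg b0, if_neg b1]; simp
      all_goals first
        | exact C_val (by omega) (by omega) (by assumption)
        | exact C_val0 (by omega) (by assumption) (by assumption)
        | exact C_val1 (by omega) (by assumption) (by assumption)
  · have e := hag 0 (by omega) (by omega) (by omega) (by omega) (by omega) (by omega) (by omega)
    obtain ⟨x, hx⟩ : ∃ x, f 0 = x := ⟨_, rfl⟩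
    have hxg : g 0 = x := by omega
    have hxh : h 0 = x := by omega
    have hx' := cd_inv hf (by omega) hx
    have hxg' := cd_inv hg (by omega) hxg
    have hxh' := cd_inv hh (by omega) hxh
    have x1 := cd_lt hf (i := 0) (by omega)
    have x2 := cd_ne hf (i := 0) (by omega)
    by_cases hx1 : x = 1
    · left; omega
    right
    by_cases hb : a0 = 1
    · subst hb
      right; left
      refine ⟨by omega, by omega, by omega, ?_⟩
      rw [bp_iff (C_cd hg) (C_cd hh) (C_cd hf)]
      have hxa : a5 < x := by
        have := hf.2 0 1 (by omega) (by omega)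
        have : x ≠ a5 := by rintro rfl; omega
        omega
      refine ⟨a1-2, a2-2, a3-2, a4-2, a5-2, x-2, by omega, by omega, by omega, by omega, by omega, by omega, ?_, ?_, ?_, ?_, ?_, ?_, ?_, ?_, ?_, ?_⟩
      · intro i hi k0 k1 k2 k3 k4 k5
        have := hag (i+2) (by omega) (by omega) (by omega) (by omega) (by omega) (by omega) (by omega)
        have b0 : f (i+2) ≠ 0 := by
          intro hh; have := cd_inv hf (by omega) hh; omega
        have b1 : f (i+2) ≠ 1 := by
          intro hh; have := cd_inv hf (by omega) hh; omega
        simp only [C, ← this.1, ← this.2]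
        rw [if_neg b0, if_neg b1, if_neg b0, if_neg b1, if_neg b0, if_neg b1]; simp
      all_goals first
        | exact C_val (by omega) (by omega) (by assumption)
        | exact C_val0 (by omega) (by assumption) (by assumption)
        | exact C_val1 (by omega) (by assumption) (by assumption)
    · left
      refine ⟨by omega, by omega, by omega, ?_⟩
      have e1 := hag 1 (by omega) (by omega) (by omega) (by omega) (by omega) (by omega) (by omega)
      rw [bp_iff (C_cd hf) (C_cd hg) (C_cd hh)]
      refine ⟨a0-2, a1-2, a2-2, a3-2, a4-2, a5-2, by omega, by omega, by omega, by omega, by omega, by omega, ?_, ?_, ?_, ?_, ?_, ?_, ?_, ?_, ?_, ?_⟩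
      · intro i hi k0 k1 k2 k3 k4 k5
        have := hag (i+2) (by omega) (by omega) (by omega) (by omega) (by omega) (by omega) (by omega)
        simp only [C, ← this.1, ← this.2, ← e.1, ← e.2, ← e1.1, ← e1.2]
        simp
      all_goals exact C_val (by omega) (by omega) (by assumption)

end CDx


namespace CDx

abbrev Q (n : ℕ) := ((ℕ → ℕ) →₀ ZMod 2) ⧸ bypassSub n
noncomputable def cls (n : ℕ) (f : ℕ → ℕ) : Q n := (bypassSub n).mkQ (Finsupp.single f 1)

theorem cls_bp {n : ℕ} {f g h : ℕ → ℕ} (hb : BypassRel n f g h) : cls n f + cls n g + cls n h = 0 := by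
  unfold cls
  rw [← map_add, ← map_add, Submodule.mkQ_apply, Submodule.Quotient.mk_eq_zero]
  exact Submodule.subset_span (Or.inl ⟨f, g, h, hb, rfl⟩)

theorem exists_lift {n : ℕ} {V : Type*} [AddCommGroup V] [Module (ZMod 2) V] (φ : (ℕ → ℕ) → V)
    (hφ : ∀ f g h, BypassRel n f g h → φ f + φ g + φ h = 0) :
    ∃ Φ : Q n →ₗ[ZMod 2] V, ∀ f, IsCD n f → Φ (cls n f) = φ f := by
  classical
  let ψ : (ℕ → ℕ) → V := fun f => if IsCD n f then φ f else 0
  let L : ((ℕ → ℕ) →₀ ZMod 2) →ₗ[ZMod 2] V := Finsupp.linearCombination (ZMod 2) ψ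
  have hL : ∀ f, L (Finsupp.single f 1) = ψ f := by
    intro f; simp [L, Finsupp.linearCombination_single]
  have hker : bypassSub n ≤ LinearMap.ker L := by
    unfold bypassSub
    rw [Submodule.span_le]
    rintro x (⟨f, g, h, hb, rfl⟩ | ⟨f, hf, rfl⟩)
    · simp only [SetLike.mem_coe, LinearMap.mem_ker, map_add, hL]
      simp only [ψ, if_pos hb.1, if_pos hb.2.1, if_pos hb.2.2.1]
      exact hφ f g h hb
    · simp only [SetLike.mem_coe, LinearMap.mem_ker, hL]
      simp only [ψ, if_neg hf]
  refine ⟨(bypassSub n).liftQ L hker, ?_⟩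
  intro f hf
  unfold cls
  rw [Submodule.mkQ_apply, Submodule.liftQ_apply, hL]
  simp only [ψ, if_pos hf]

theorem exists_P (n : ℕ) : ∃ Φ : Q n →ₗ[ZMod 2] Q (n+1), ∀ f, IsCD n f → Φ (cls n f) = cls (n+1) (P f) :=
  exists_lift _ fun _ _ _ hb => cls_bp (P_bp hb)

theorem exists_M (n : ℕ) : ∃ Φ : Q n →ₗ[ZMod 2] Q n, ∀ f, IsCD n f → Φ (cls n f) = cls n (M n f) :=
  exists_lift _ fun f g h hb => by
    have := cls_bp (M_bp hb)
    rw [← this]; abel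

theorem exists_S (n : ℕ) : ∃ Φ : Q n →ₗ[ZMod 2] Q n, ∀ f, IsCD n f → Φ (cls n f) = cls n (S n f) :=
  exists_lift _ fun f g h hb => by
    rcases S_bp hb with h | h <;> (rw [← cls_bp h]; abel)

theorem add_self_Q {n : ℕ} (x : Q n) : x + x = 0 := by
  rw [← two_smul (ZMod 2) x]
  have : (2 : ZMod 2) = 0 := rfl
  rw [this, zero_smul]

theorem exists_C (n : ℕ) : ∃ Φ : Q (n+1) →ₗ[ZMod 2] Q n, ∀ f, IsCD (n+1) f →
    Φ (cls (n+1) f) = if f 0 = 1 then 0 else cls n (C f) :=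
  exists_lift _ fun f g h hb => by
    rcases C_bp hb with ⟨h1, h2, h3⟩ | ⟨h1, h2, h3, h4⟩ | ⟨h1, h2, h3, h4⟩ | ⟨h1, h2, h3, h4⟩
    · simp [h1, h2, h3]
    · rw [if_neg h1, if_neg h2, if_neg h3, cls_bp h4]
    · rw [if_neg h1, if_neg h2, if_neg h3, ← cls_bp h4]; abel
    · rw [if_neg h1, if_pos h2, if_neg h3, h4, add_zero, add_self_Q]

def f01 : ℕ → ℕ := fun j => if j = 0 then 1 else if j = 1 then 0 else j

theorem f01_cd : IsCD 1 f01 := by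
  refine ⟨⟨?_, ?_, ?_, ?_⟩, ?_⟩
  · intro i hi; simp only [f01]; grind
  · intro i hi; simp only [f01]; grind
  · intro i hi; simp only [f01]; grind
  · intro i hi; simp only [f01]; grind
  · rintro a b ha hb ⟨k1, k2, k3⟩
    simp only [f01] at k2 k3; grind

theorem cd_one {f : ℕ → ℕ} (hf : IsCD 1 f) : f = f01 := by
  obtain ⟨⟨h1, h2, h3, h4⟩, h5⟩ := hf
  have := h1 0 (by omega)
  have := h1 1 (by omega)
  have := h3 0 (by omega)
  have := h3 1 (by omega)
  funext j
  have := h4 j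
  simp only [f01]
  split_ifs with a b
  · subst a; omega
  · subst b; omega
  · omega

/-- recursive description of the basis diagrams -/
def G : List Bool → ℕ → ℕ
  | [] => f01
  | true :: w => P (G w)
  | false :: w => S (w.length + 2) (P (S (w.length + 1) (G w)))

theorem G_cd (w : List Bool) : IsCD (w.length + 1) (G w) := by
  induction w with
  | nil => exact f01_cd
  | cons b w ih =>
    cases b
    · exact S_cd (P_cd (S_cd ih))
    · exact P_cd ih

theorem S_P_zero {n : ℕ} (hn : 0 < n) (f : ℕ → ℕ) : S (n+1) (P f) 0 ≠ 1 := by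
  simp only [S, sg, P]; simp; omega

theorem exists_dual (m : ℕ) (w : List Bool) (hw : w.length = m) :
    ∃ φ : Q (m+1) →ₗ[ZMod 2] ZMod 2, ∀ v : List Bool, v.length = m →
      φ (cls (m+1) (G v)) = if v = w then 1 else 0 := by
  induction m generalizing w with
  | zero =>
    obtain ⟨Φ, hΦ⟩ := exists_lift (n := 1) (V := ZMod 2) (fun _ => 1) (by
      intro f g h hb
      obtain ⟨_, _, _, _, _, _, hb⟩ := (bp_iff hb.1 hb.2.1 hb.2.2.1).1 hb
      obtain ⟨h0, h1, h2, h3, h4, h5, -⟩ := hb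
      omega)
    refine ⟨Φ, ?_⟩
    intro v hv
    rw [List.length_eq_zero_iff] at hv hw
    subst hv hw
    rw [if_pos rfl]
    exact hΦ _ f01_cd
  | succ m ih =>
    obtain ⟨CC, hC⟩ := exists_C (m+1)
    obtain ⟨SS, hS⟩ := exists_S (m+1)
    obtain ⟨SS', hS'⟩ := exists_S (m+2)
    obtain ⟨MM, hM⟩ := exists_M (m+1)
    match w, hw with
    | b :: w, hw =>
      have hw' : w.length = m := by simpa using hw
      obtain ⟨φ, hφ⟩ := ih w hw'
      have key : ∀ f, IsCD (m+1) f → MM (SS (MM (CC (cls (m+2) (S (m+2) (P f)))))) = cls (m+1) f := by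
        intro f hf
        rw [hC _ (S_cd (P_cd hf)), if_neg (S_P_zero (by omega) f), C_S_P (by omega) hf,
          hM _ (M_cd (S_cd (M_cd hf))), M_M (S_cd (M_cd hf)), hS _ (S_cd (M_cd hf)),
          S_S (M_cd hf), hM _ (M_cd hf), M_M hf]
      have kill : ∀ f, IsCD (m+1) f → CC (cls (m+2) (P f)) = 0 := by
        intro f hf
        rw [hC _ (P_cd hf), if_pos (by simp [P])]
      cases b
      · refine ⟨φ ∘ₗ SS ∘ₗ MM ∘ₗ SS ∘ₗ MM ∘ₗ CC, ?_⟩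
        intro v hv
        match v, hv with
        | true :: v, hv =>
          have hv' : v.length = m := by simpa using hv
          have cd := G_cd v
          rw [hv'] at cd
          simp only [LinearMap.comp_apply, G, kill _ cd, map_zero]
          simp
        | false :: v, hv =>
          have hv' : v.length = m := by simpa using hv
          have cd := G_cd v
          rw [hv'] at cd
          simp only [LinearMap.comp_apply, G, hv', key _ (S_cd cd), hS _ (S_cd cd), S_S cd, hφ v hv']
          simp
      · refine ⟨φ ∘ₗ MM ∘ₗ SS ∘ₗ MM ∘ₗ CC ∘ₗ SS', ?_⟩
        intro v hv
        match v, hv with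
        | true :: v, hv =>
          have hv' : v.length = m := by simpa using hv
          have cd := G_cd v
          rw [hv'] at cd
          simp only [LinearMap.comp_apply, G, hS' _ (P_cd cd), key _ cd, hφ v hv']
          simp
        | false :: v, hv =>
          have hv' : v.length = m := by simpa using hv
          have cd := G_cd v
          rw [hv'] at cd
          simp only [LinearMap.comp_apply, G, hv', hS' _ (S_cd (P_cd (S_cd cd))), S_S (P_cd (S_cd cd)),
            kill _ (S_cd cd), map_zero]
          simp

end CDx


namespace CDx

theorem cd_parity {n : ℕ} {f : ℕ → ℕ} (hf : IsCD n f) {i : ℕ} (hi : i < 2*n) : (i + f i) % 2 = 1 := by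
  have main : ∀ i, i < 2*n → i < f i → (i + f i) % 2 = 1 := by
    intro i hi hif
    have hl := cd_lt hf hi
    have hinv : f (f i) = i := cd_inv hf hi rfl
    have hs : ∑ x ∈ Finset.Ioo i (f i), (1 : ZMod 2) = 0 := by
      refine Finset.sum_involution (fun a _ => f a) ?_ ?_ ?_ ?_
      · intro a ha; rfl
      · intro a ha _
        rw [Finset.mem_Ioo] at ha
        exact cd_ne hf (by omega)
      · intro a ha
        rw [Finset.mem_Ioo] at ha ⊢
        have h1 := cd_lt hf (i := a) (by omega)
        have h2 : f (f a) = a := cd_inv hf (by omega) rfl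
        have h3 := hf.2 i a hi (by omega)
        have h4 := hf.2 (f a) i h1 hi
        rw [h2] at h4
        have h5 : f a ≠ f i := by
          intro e; rw [e] at h2; omega
        have h6 : f a ≠ i := by
          intro e; rw [e] at h2; omega
        omega
      · intro a ha
        rw [Finset.mem_Ioo] at ha
        exact cd_inv hf (by omega) rfl
    rw [Finset.sum_const, nsmul_eq_mul, mul_one, Nat.card_Ioo, ZMod.natCast_eq_zero_iff] at hs
    omega
  have hl := cd_lt hf hi
  have hinv : f (f i) = i := cd_inv hf hi rfl
  have hne := cd_ne hf hi
  rcases Nat.lt_or_ge i (f i) with h | h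
  · exact main i hi h
  · have := main (f i) hl (by omega)
    rw [hinv] at this; omega

def sgn (i : ℕ) : ℤ := if Even i then 1 else -1

theorem sgn_eq (i : ℕ) : (i % 2 = 0 ∧ sgn i = 1) ∨ (i % 2 = 1 ∧ sgn i = -1) := by
  unfold sgn
  rcases Nat.even_or_odd i with h | h
  · left; exact ⟨Nat.even_iff.1 h, if_pos h⟩
  · right; exact ⟨Nat.odd_iff.1 h, if_neg (Nat.not_even_iff_odd.2 h)⟩

theorem euler_def (n : ℕ) (f : ℕ → ℕ) :
    eulerClass n f = -1 + ∑ i ∈ Finset.range (2*n), (if i < f i then sgn i else 0) := rfl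

theorem euler_P (n : ℕ) (f : ℕ → ℕ) : eulerClass (n+1) (P f) = eulerClass n f + 1 := by
  rw [euler_def, euler_def]
  have : 2*(n+1) = 2*n+1+1 := by ring
  rw [this, Finset.sum_range_succ', Finset.sum_range_succ']
  have : ∀ i ∈ Finset.range (2*n), (if i + 1 + 1 < P f (i+1+1) then sgn (i+1+1) else 0)
      = if i < f i then sgn i else 0 := by
    intro i _
    have e : P f (i+1+1) = f i + 2 := by simp [P]
    rw [e]
    have := sgn_eq i
    have := sgn_eq (i+1+1)
    split_ifs <;> omega
  rw [Finset.sum_congr rfl this]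
  have : sgn 0 = 1 := rfl
  simp [P, this]

theorem sum_sgn (n : ℕ) : ∑ i ∈ Finset.range (2*n), sgn i = 0 := by
  induction n with
  | zero => rfl
  | succ n ih =>
    have : 2*(n+1) = 2*n+1+1 := by ring
    rw [this, Finset.sum_range_succ, Finset.sum_range_succ, ih]
    have := sgn_eq (2*n)
    have := sgn_eq (2*n+1)
    omega

theorem euler_S {n : ℕ} (hn : 0 < n) {f : ℕ → ℕ} (hf : IsCD n f) :
    eulerClass n (S n f) = - eulerClass n f := by
  rw [euler_def, euler_def]
  have hs := sum_sgn n
  obtain ⟨k, hk⟩ : ∃ k, 2*n = k+1 := ⟨2*n-1, by omega⟩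
  have hf0 : f 0 < 2*n := cd_lt hf (by omega)
  have hne : f 0 ≠ 0 := cd_ne hf (by omega)
  have hpar := cd_parity hf (i := 0) (by omega)
  have key : ∀ i ∈ Finset.range k, (if k-1-i+1 < S n f (k-1-i+1) then sgn (k-1-i+1) else 0) =
      sgn (i+1) - (if i + 1 = f 0 then sgn (i+1) else 0) - (if i+1 < f (i+1) then sgn (i+1) else 0) := by
    intro i hi
    rw [Finset.mem_range] at hi
    have e : k-1-i+1 = 2*n-(i+1) := by omega
    rw [e]
    have s1 := sgn_eq (i+1)
    have s2 := sgn_eq (2*n-(i+1))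
    by_cases h0 : i+1 = f 0
    · have e0 : f (i+1) = 0 := cd_inv hf (by omega) h0.symm
      have : S n f (2*n-(i+1)) = 0 := by
        have l : 2*n-(i+1) < 2*n := by omega
        have l2 : 2*n-(i+1) ≠ 0 := by omega
        have l3 : 2*n-(2*n-(i+1)) = i+1 := by omega
        simp only [S, sg, if_pos l, if_neg l2, l3, e0, if_true]
      rw [this, e0, if_pos h0]
      simp
    · have e0 : f (i+1) ≠ 0 := by
        intro e; have := cd_inv hf (by omega) e; omega
      have hl := cd_lt hf (i := i+1) (by omega)
      have hn1 := cd_ne hf (i := i+1) (by omega)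
      rw [S_val (by omega) (by omega) e0 rfl, if_neg h0]
      split_ifs <;> omega
  rw [hk, Finset.sum_range_succ'] at hs ⊢
  rw [Finset.sum_range_succ', ← Finset.sum_range_reflect, Finset.sum_congr rfl key,
    Finset.sum_sub_distrib, Finset.sum_sub_distrib]
  have e1 : ∑ i ∈ Finset.range k, (if i + 1 = f 0 then sgn (i+1) else 0) = -1 := by
    rw [Finset.sum_eq_single (f 0 - 1)]
    · have : f 0 - 1 + 1 = f 0 := by omega
      rw [this, if_pos rfl]
      have := sgn_eq (f 0); omega
    · intro b _ hb
      rw [if_neg (by omega)]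
    · intro h; rw [Finset.mem_range] at h; omega
  have e2 : S n f 0 = 2*n - f 0 := S_val0 (by omega) hne rfl
  have e3 : sgn 0 = 1 := rfl
  rw [e1, e2, if_pos (by omega), if_pos (by omega), e3]
  rw [e3] at hs
  linarith

theorem euler_bp {n : ℕ} {f g h : ℕ → ℕ} (hf : IsCD n f) (hg : IsCD n g) (hh : IsCD n h)
    {a0 a1 a2 a3 a4 a5 : ℕ} (hb : BP n f g h a0 a1 a2 a3 a4 a5) :
    eulerClass n f = eulerClass n h ∧ eulerClass n g = eulerClass n h := by
  obtain ⟨h0, h1, h2, h3, h4, h5, hag, r1, r2, r3, r4, r5, r6, r7, r8, r9⟩ := hb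
  have r1' := cd_inv hf (by omega) r1
  have r2' := cd_inv hf (by omega) r2
  have r3' := cd_inv hf (by omega) r3
  have r4' := cd_inv hg (by omega) r4
  have r5' := cd_inv hg (by omega) r5
  have r6' := cd_inv hg (by omega) r6
  have r7' := cd_inv hh (by omega) r7
  have r8' := cd_inv hh (by omega) r8
  have r9' := cd_inv hh (by omega) r9
  have p1 := cd_parity hf (i := a0) (by omega)
  have p2 := cd_parity hf (i := a1) (by omega)
  have p3 := cd_parity hf (i := a2) (by omega)
  have p4 := cd_parity hg (i := a0) (by omega)
  have p5 := cd_parity hg (i := a2) (by omega)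
  rw [r1] at p1
  rw [r2] at p2
  rw [r3] at p3
  rw [r4] at p4
  rw [r5] at p5
  have s0 := sgn_eq a0
  have s1 := sgn_eq a1
  have s2 := sgn_eq a2
  have s3 := sgn_eq a3
  have s4 := sgn_eq a4
  have s5 := sgn_eq a5
  have split : ∀ F : ℕ → ℤ, (∀ i, i < 2*n → i ≠ a0 → i ≠ a1 → i ≠ a2 → i ≠ a3 → i ≠ a4 → i ≠ a5 → F i = 0) →
      ∑ i ∈ Finset.range (2*n), F i = F a0 + (F a1 + (F a2 + (F a3 + (F a4 + F a5)))) := by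
    intro F hF
    have : ∑ i ∈ ({a0, a1, a2, a3, a4, a5} : Finset ℕ), F i = ∑ i ∈ Finset.range (2*n), F i := by
      apply Finset.sum_subset
      · intro x hx
        simp only [Finset.mem_insert, Finset.mem_singleton] at hx
        rw [Finset.mem_range]; omega
      · intro x hx hx'
        simp only [Finset.mem_insert, Finset.mem_singleton, not_or] at hx'
        rw [Finset.mem_range] at hx
        exact hF x hx hx'.1 hx'.2.1 hx'.2.2.1 hx'.2.2.2.1 hx'.2.2.2.2.1 hx'.2.2.2.2.2
    rw [← this, Finset.sum_insert, Finset.sum_insert, Finset.sum_insert, Finset.sum_insert,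
      Finset.sum_insert, Finset.sum_singleton]
    all_goals simp only [Finset.mem_insert, Finset.mem_singleton, not_or]; omega
  have t1 : sgn a1 = - sgn a0 := by clear s2 s3 s4 s5; omega
  have t2 : sgn a2 = sgn a0 := by clear s1 s3 s4; omega
  have t3 : sgn a3 = - sgn a0 := by clear s1 s4; omega
  have t4 : sgn a4 = sgn a0 := by clear s2 s3 s5; omega
  clear s0 s1 s2 s3 s4 s5
  have c1 := split (fun i => (if i < f i then sgn i else 0) - (if i < h i then sgn i else 0)) (by
    intro i hi k0 k1 k2 k3 k4 k5
    have := hag i hi k0 k1 k2 k3 k4 k5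
    simp only [← this.2, sub_self])
  have c2 := split (fun i => (if i < g i then sgn i else 0) - (if i < h i then sgn i else 0)) (by
    intro i hi k0 k1 k2 k3 k4 k5
    have := hag i hi k0 k1 k2 k3 k4 k5
    simp only [← this.1, ← this.2, sub_self])
  simp only [Finset.sum_sub_distrib] at c1 c2
  simp only [r1, r2, r3, r4, r5, r6, r7, r8, r9, r1', r2', r3', r4', r5', r6', r7', r8', r9'] at c1 c2
  rw [euler_def, euler_def, euler_def]
  have u05 : a0 < a5 := by omega
  have u14 : a1 < a4 := by omega
  have u03 : a0 < a3 := by omega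
  have u25 : a2 < a5 := by omega
  simp only [if_pos u05, if_pos u14, if_pos u03, if_pos u25, if_pos h0, if_pos h1, if_pos h2, if_pos h3,
    if_pos h4, if_neg u05.asymm, if_neg u14.asymm, if_neg u03.asymm, if_neg u25.asymm, if_neg h0.asymm,
    if_neg h1.asymm, if_neg h2.asymm, if_neg h3.asymm, if_neg h4.asymm, t1, t2, t3, t4] at c1 c2
  constructor
  · linarith
  · linarith

set_option maxHeartbeats 2000000 in
/-- the decomposition of a diagram without outermost chord at the base point -/
theorem decomp {n : ℕ} {h : ℕ → ℕ} (hh : IsCD (n+1) h) (hn1 : h 0 ≠ 1) (hn2 : h 0 ≠ 2*n+1) :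
    ∃ f g, IsCD (n+1) f ∧ IsCD (n+1) g ∧ f 0 = 2*n+1 ∧ g 0 = 1 ∧
      eulerClass (n+1) f = eulerClass (n+1) h ∧ eulerClass (n+1) g = eulerClass (n+1) h ∧
      BypassRel (n+1) f g h := by
  obtain ⟨c, hc⟩ : ∃ c, h 0 = c := ⟨_, rfl⟩
  obtain ⟨a, ha⟩ : ∃ a, h 1 = a := ⟨_, rfl⟩
  obtain ⟨b, hb⟩ : ∃ b, h (2*n+1) = b := ⟨_, rfl⟩
  have hc' := cd_inv hh (by omega) hc
  have ha' := cd_inv hh (by omega) ha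
  have hb' := cd_inv hh (by omega) hb
  have c1 := cd_lt hh (i := 0) (by omega)
  have a1 := cd_lt hh (i := 1) (by omega)
  have b1 := cd_lt hh (i := 2*n+1) (by omega)
  have c2 := cd_ne hh (i := 0) (by omega)
  have a2 := cd_ne hh (i := 1) (by omega)
  have b2 := cd_ne hh (i := 2*n+1) (by omega)
  have a3 : a ≠ 0 := by rintro rfl; omega
  have a4 : a ≠ c := by rintro rfl; omega
  have b3 : b ≠ 0 := by rintro rfl; omega
  have b4 : b ≠ c := by rintro rfl; omega
  have x1 := hh.2 0 1 (by omega) (by omega)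
  have x2 := hh.2 0 b (by omega) (by omega)
  have hac : a < c := by omega
  have hcb : c < b := by omega
  have reg : ∀ i, i < 2*(n+1) → i ≠ 0 → i ≠ 1 → i ≠ a → i ≠ c → i ≠ b → i ≠ 2*n+1 →
      (1 < i ∧ i < a ∧ 1 < h i ∧ h i < a) ∨ (a < i ∧ i < c ∧ a < h i ∧ h i < c) ∨
      (c < i ∧ i < b ∧ c < h i ∧ h i < b) ∨ (b < i ∧ i < 2*n+1 ∧ b < h i ∧ h i < 2*n+1) := by
    intro i hi k0 k1 k2 k3 k4 k5
    obtain ⟨x, hx⟩ : ∃ x, h i = x := ⟨_, rfl⟩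
    have hx' := cd_inv hh (by omega) hx
    have := cd_lt hh (i := i) (by omega)
    have e0 : x ≠ 0 := by rintro rfl; omega
    have e1 : x ≠ 1 := by rintro rfl; omega
    have e2 : x ≠ a := by rintro rfl; omega
    have e3 : x ≠ b := by rintro rfl; omega
    have e4 : x ≠ c := by rintro rfl; omega
    have e5 : x ≠ 2*n+1 := by rintro rfl; omega
    have y1 : i < c → x < c := by have := hh.2 0 i (by omega) (by omega); omega
    have y2 : x < c → i < c := by have := hh.2 0 x (by omega) (by omega); omega
    have y3 : i < a → x < a := by have := hh.2 1 i (by omega) (by omega); omega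
    have y4 : x < a → i < a := by have := hh.2 1 x (by omega) (by omega); omega
    have y5 : i < b → x < b := by have := hh.2 i b (by omega) (by omega); omega
    have y6 : x < b → i < b := by have := hh.2 x b (by omega) (by omega); omega
    have hxlt : x < 2*(n+1) := by omega
    rw [hx]
    clear x1 x2 hx hx' hc ha hb hc' ha' hb'
    rcases Nat.lt_or_ge i a with z | z
    · left; omega
    rcases Nat.lt_or_ge i c with z | z
    · right; left; omega
    rcases Nat.lt_or_ge i b with z | z
    · right; right; left; omega
    · right; right; right; omega
  have hinv : ∀ i, i < 2*(n+1) → h (h i) = i := hh.1.2.1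
  have hfix := hh.1.2.2.1
  have hout := hh.1.2.2.2
  clear x1 x2
  let f : ℕ → ℕ := fun i => if i = 0 then 2*n+1 else if i = 2*n+1 then 0 else if i = 1 then b
    else if i = b then 1 else if i = a then c else if i = c then a else h i
  let g : ℕ → ℕ := fun i => if i = 0 then 1 else if i = 1 then 0 else if i = a then 2*n+1
    else if i = 2*n+1 then a else if i = b then c else if i = c then b else h i
  have hf : IsCD (n+1) f := by
    refine ⟨⟨?_, ?_, ?_, ?_⟩, ?_⟩
    · intro i hi
      have := reg i hi
      simp only [f]; split_ifs <;> omega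
    · intro i hi
      have := reg i hi
      have := hinv i hi
      have v0 : f (0) = 2*n+1 := by simp only [f]; split_ifs <;> first | omega | contradiction
      have v1 : f (2*n+1) = 0 := by simp only [f]; split_ifs <;> first | omega | contradiction
      have v2 : f (1) = b := by simp only [f]; split_ifs <;> first | omega | contradiction
      have v3 : f (b) = 1 := by simp only [f]; split_ifs <;> first | omega | contradiction
      have v4 : f (a) = c := by simp only [f]; split_ifs <;> first | omega | contradiction
      have v5 : f (c) = a := by simp only [f]; split_ifs <;> first | omega | contradiction
      by_cases q0 : i = 0
      · rw [q0, v0, v1]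
      by_cases q1 : i = 2*n+1
      · rw [q1, v1, v0]
      by_cases q2 : i = 1
      · rw [q2, v2, v3]
      by_cases q3 : i = b
      · rw [q3, v3, v2]
      by_cases q4 : i = a
      · rw [q4, v4, v5]
      by_cases q5 : i = c
      · rw [q5, v5, v4]
      have fo : ∀ j, j ≠ 0 → j ≠ 1 → j ≠ a → j ≠ c → j ≠ b → j ≠ 2*n+1 → f j = h j := by
        intro j k0 k1 k2 k3 k4 k5
        simp [f, k0, k1, k2, k3, k4, k5]
      have r : f i = h i := fo i (by omega) (by omega) (by omega) (by omega) (by omega) (by omega)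
      have r2 : f (h i) = h (h i) :=
        fo (h i) (by omega) (by omega) (by omega) (by omega) (by omega) (by omega)
      rw [r, r2]; assumption
    · intro i hi
      have := reg i hi
      have := hfix i hi
      simp only [f]; split_ifs <;> omega
    · intro i hi
      have := hout i hi
      simp only [f]; split_ifs <;> omega
    · rintro x y hx hy ⟨k1, k2, k3⟩
      have r1 := reg x hx
      have r2 := reg y hy
      have := hh.2 x y hx hy
      simp only [f] at k2 k3
      split_ifs at k2 k3 <;> omega
  have hg : IsCD (n+1) g := by
    refine ⟨⟨?_, ?_, ?_, ?_⟩, ?_⟩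
    · intro i hi
      have := reg i hi
      simp only [g]; split_ifs <;> omega
    · intro i hi
      have := reg i hi
      have := hinv i hi
      have v0 : g (0) = 1 := by simp only [g]; split_ifs <;> first | omega | contradiction
      have v1 : g (1) = 0 := by simp only [g]; split_ifs <;> first | omega | contradiction
      have v2 : g (a) = 2*n+1 := by simp only [g]; split_ifs <;> first | omega | contradiction
      have v3 : g (2*n+1) = a := by simp only [g]; split_ifs <;> first | omega | contradiction
      have v4 : g (b) = c := by simp only [g]; split_ifs <;> first | omega | contradiction
      have v5 : g (c) = b := by simp only [g]; split_ifs <;> first | omega | contradiction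
      by_cases q0 : i = 0
      · rw [q0, v0, v1]
      by_cases q1 : i = 1
      · rw [q1, v1, v0]
      by_cases q2 : i = a
      · rw [q2, v2, v3]
      by_cases q3 : i = 2*n+1
      · rw [q3, v3, v2]
      by_cases q4 : i = b
      · rw [q4, v4, v5]
      by_cases q5 : i = c
      · rw [q5, v5, v4]
      have fo : ∀ j, j ≠ 0 → j ≠ 1 → j ≠ a → j ≠ c → j ≠ b → j ≠ 2*n+1 → g j = h j := by
        intro j k0 k1 k2 k3 k4 k5
        simp [g, k0, k1, k2, k3, k4, k5]
      have r : g i = h i := fo i (by omega) (by omega) (by omega) (by omega) (by omega) (by omega)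
      have r2 : g (h i) = h (h i) :=
        fo (h i) (by omega) (by omega) (by omega) (by omega) (by omega) (by omega)
      rw [r, r2]; assumption
    · intro i hi
      have := reg i hi
      have := hfix i hi
      simp only [g]; split_ifs <;> omega
    · intro i hi
      have := hout i hi
      simp only [g]; split_ifs <;> omega
    · rintro x y hx hy ⟨k1, k2, k3⟩
      have r1 := reg x hx
      have r2 := reg y hy
      have := hh.2 x y hx hy
      simp only [g] at k2 k3
      split_ifs at k2 k3 <;> omega
  have hbp : BP (n+1) f g h 0 1 a c b (2*n+1) := by
    refine ⟨by omega, by omega, by omega, by omega, by omega, by omega, ?_, ?_, ?_, ?_, ?_, ?_, ?_, hc, ha, hb'⟩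
    · intro i hi k0 k1 k2 k3 k4 k5
      simp [f, g, k0, k1, k2, k3, k4, k5]
    all_goals (simp only [f, g]; split_ifs <;> first | omega | contradiction)
  have e := euler_bp hf hg hh hbp
  refine ⟨f, g, hf, hg, rfl, rfl, e.1, e.2, ?_⟩
  rw [bp_iff hf hg hh]
  exact ⟨_, _, _, _, _, _, hbp⟩

def ew (w : List Bool) : ℤ := (w.count true : ℤ) - w.count false

theorem euler_G (w : List Bool) : eulerClass (w.length+1) (G w) = ew w := by
  induction w with
  | nil => rfl
  | cons b w ih =>
    cases b
    · have h1 := euler_S (n := w.length + 2) (by omega) (P_cd (S_cd (G_cd w)))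
      have h2 := euler_P (w.length+1) (S (w.length+1) (G w))
      have h3 := euler_S (n := w.length + 1) (by omega) (G_cd w)
      simp only [G, List.length_cons]
      rw [h1, h2, h3, ih]
      simp [ew]; ring
    · simp only [G, List.length_cons]
      rw [euler_P, ih]
      simp [ew]; ring

theorem span_aux (m : ℕ) (f : ℕ → ℕ) (hf : IsCD (m+1) f) :
    cls (m+1) f ∈ Submodule.span (ZMod 2)
      {x | ∃ w : List Bool, w.length = m ∧ ew w = eulerClass (m+1) f ∧ x = cls (m+1) (G w)} := by
  induction m generalizing f with
  | zero =>
    apply Submodule.subset_span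
    refine ⟨[], rfl, ?_, ?_⟩
    · rw [cd_one hf]; rfl
    · rw [cd_one hf]; rfl
  | succ m ih =>
    obtain ⟨PP, hP⟩ := exists_P (m+1)
    obtain ⟨SS, hS⟩ := exists_S (m+1)
    obtain ⟨SS', hS'⟩ := exists_S (m+2)
    have caseP : ∀ f, IsCD (m+2) f → f 0 = 1 → cls (m+2) f ∈ Submodule.span (ZMod 2)
        {x | ∃ w : List Bool, w.length = m+1 ∧ ew w = eulerClass (m+2) f ∧ x = cls (m+2) (G w)} := by
      intro f hf h0
      have hc := C_cd hf
      have e := euler_P (m+1) (C f)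
      rw [P_C hf h0] at e
      have := Submodule.mem_map_of_mem (f := PP) (ih _ hc)
      rw [hP _ hc, P_C hf h0] at this
      refine (Submodule.map_span_le _ _ _).2 ?_ this
      rintro x ⟨w, hw, ew', rfl⟩
      have cd := G_cd w
      rw [hw] at cd
      rw [hP _ cd]
      apply Submodule.subset_span
      refine ⟨true :: w, by simp [hw], ?_, rfl⟩
      rw [e, ← ew']
      simp [ew]; ring
    have caseS : ∀ f, IsCD (m+2) f → f 0 = 2*(m+1)+1 → cls (m+2) f ∈ Submodule.span (ZMod 2)
        {x | ∃ w : List Bool, w.length = m+1 ∧ ew w = eulerClass (m+2) f ∧ x = cls (m+2) (G w)} := by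
      intro f hf h0
      have hs := S_cd hf
      have hs0 : S (m+2) f 0 = 1 := by
        rw [S_val0 (by omega) (by omega) h0]; omega
      have hc := C_cd hs
      have hsc := S_cd hc
      have e1 := euler_P (m+1) (C (S (m+2) f))
      have e2 := euler_S (by omega) hf
      have e3 := euler_S (by omega) hc
      rw [P_C hs hs0] at e1
      have := Submodule.mem_map_of_mem (f := SS' ∘ₗ PP ∘ₗ SS) (ih _ hsc)
      simp only [LinearMap.comp_apply] at this
      rw [hS _ hsc, S_S hc, hP _ hc, P_C hs hs0, hS' _ hs, S_S hf] at this
      refine (Submodule.map_span_le _ _ _).2 ?_ this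
      rintro x ⟨w, hw, ew', rfl⟩
      have cd := G_cd w
      rw [hw] at cd
      simp only [LinearMap.comp_apply]
      rw [hS _ cd, hP _ (S_cd cd), hS' _ (P_cd (S_cd cd))]
      apply Submodule.subset_span
      refine ⟨false :: w, by simp [hw], ?_, ?_⟩
      · have : ew (false :: w) = ew w - 1 := by simp [ew]; ring
        rw [this, ew']; linarith
      · simp only [G, hw]
    by_cases h1 : f 0 = 1
    · exact caseP f hf h1
    by_cases h2 : f 0 = 2*(m+1)+1
    · exact caseS f hf h2
    obtain ⟨f', g', hf', hg', hf0, hg0, ef, eg, hb⟩ := decomp hf h1 h2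
    have k1 := caseS f' hf' hf0
    have k2 := caseP g' hg' hg0
    rw [ef] at k1
    rw [eg] at k2
    have hs := cls_bp hb
    have : cls (m+2) f = cls (m+2) f' + cls (m+2) g' := by
      have h3 := add_self_Q (cls (m+2) f)
      have h4 := (add_eq_zero_iff_eq_neg.1 hs)
      have h5 := (add_eq_zero_iff_eq_neg.1 h3)
      exact h5.trans h4.symm
    change cls (m+2) f ∈ _
    rw [this]
    exact Submodule.add_mem _ k1 k2

end CDx

namespace CDx

def Good (n : ℕ) (L : List (ℕ × ℕ)) (g : ℕ → ℕ) : Prop :=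
  (∀ pr ∈ L, pr.1 < 2*n ∧ pr.2 < 2*n ∧ g pr.1 = pr.2 ∧ g pr.2 = pr.1) ∧
  (∀ a, a < 2*n → ∃ pr ∈ L, pr.1 = a ∨ pr.2 = a) ∧ (∀ a, ¬ a < 2*n → g a = a)

theorem Good.eq {n : ℕ} {w : List Bool} {g : ℕ → ℕ} (h : Good n (gammaPairs w) g) :
    gammaWord w = g := by
  obtain ⟨h1, h2, h3⟩ := h
  funext a
  unfold gammaWord
  cases hf : (gammaPairs w).find? (fun pr => pr.1 == a || pr.2 == a) with
  | none =>
    by_cases ha : a < 2*n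
    · obtain ⟨pr, hp, hpa⟩ := h2 a ha
      have := List.find?_eq_none.1 hf pr hp
      simp at this
      omega
    · exact (h3 a ha).symm
  | some pr =>
    have hm := List.mem_of_find?_eq_some hf
    have hp := List.find?_some hf
    obtain ⟨k1, k2, k3, k4⟩ := h1 pr hm
    simp at hp
    simp only
    split_ifs with hc
    · rw [← hc, k3]
    · rcases hp with hp | hp
      · exact absurd hp hc
      · rw [← hp, k4]

theorem Good.map {n : ℕ} {L : List (ℕ × ℕ)} {g g' τ : ℕ → ℕ} {u v : ℕ} (h : Good n L g)
    (t1 : ∀ j, j < 2*n → τ j < 2*(n+1)) (t2 : ∀ j, j < 2*n → g' (τ j) = τ (g j))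
    (hu : u < 2*(n+1)) (hv : v < 2*(n+1)) (huv : g' u = v) (hvu : g' v = u)
    (t3 : ∀ a, a < 2*(n+1) → a = u ∨ a = v ∨ ∃ j, j < 2*n ∧ τ j = a)
    (t4 : ∀ a, ¬ a < 2*(n+1) → g' a = a) :
    Good (n+1) ((u, v) :: L.map (fun pr => (τ pr.1, τ pr.2))) g' := by
  obtain ⟨h1, h2, h3⟩ := h
  refine ⟨?_, ?_, t4⟩
  · intro pr hpr
    rcases List.mem_cons.1 hpr with rfl | hpr
    · exact ⟨hu, hv, huv, hvu⟩
    · obtain ⟨q, hq, rfl⟩ := List.mem_map.1 hpr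
      obtain ⟨k1, k2, k3, k4⟩ := h1 q hq
      refine ⟨t1 _ k1, t1 _ k2, ?_, ?_⟩
      · simp only [t2 _ k1, k3]
      · simp only [t2 _ k2, k4]
  · intro a ha
    rcases t3 a ha with rfl | rfl | ⟨j, hj, rfl⟩
    · exact ⟨_, List.mem_cons_self, Or.inl rfl⟩
    · exact ⟨_, List.mem_cons_self, Or.inr rfl⟩
    · obtain ⟨q, hq, hqa⟩ := h2 j hj
      refine ⟨_, List.mem_cons_of_mem _ (List.mem_map_of_mem hq), ?_⟩
      rcases hqa with rfl | rfl
      · exact Or.inl rfl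
      · exact Or.inr rfl

theorem count_pos_take {w : List Bool} {p : ℕ} {b : Bool} (h0 : p ≠ 0) (hp : p < w.length)
    (h : w.getD (p-1) true = b) : 1 ≤ (w.take p).count b := by
  have : b ∈ w.take p := by
    rw [List.mem_take_iff_getElem]
    refine ⟨p-1, by omega, ?_⟩
    rw [List.getD_eq_getElem _ _ (by omega)] at h
    exact h
  exact List.count_pos_iff.2 this

theorem count_tf (l : List Bool) : l.count true + l.count false = l.length := by
  induction l with
  | nil => rfl
  | cons b l ih => cases b <;> simp <;> omega

def upT (x : ℤ) : ℤ := if x < 0 then x else x + 2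
def upF (x : ℤ) : ℤ := if 0 < x then x else x - 2

theorem chordAt_range {w : List Bool} {p : ℕ} (hp : p < w.length) :
    (-(2*(w.length:ℤ)+2) < (chordAt w p).1 ∧ (chordAt w p).1 < 2*(w.length:ℤ)+2) ∧
    (-(2*(w.length:ℤ)+2) < (chordAt w p).2 ∧ (chordAt w p).2 < 2*(w.length:ℤ)+2) := by
  have h := count_tf (w.take p)
  rw [List.length_take] at h
  unfold chordAt
  simp only
  split_ifs <;> simp only <;> omega

theorem chordAt_true {w : List Bool} {p : ℕ} (hp : p < w.length) :
    chordAt (true :: w) (p+1) = (upT (chordAt w p).1, upT (chordAt w p).2) := by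
  have hF := fun h0 => count_pos_take (w := w) (p := p) (b := false) h0 hp
  have hT := fun h0 => count_pos_take (w := w) (p := p) (b := true) h0 hp
  unfold chordAt
  simp only [List.take_succ_cons, List.getD_cons_succ, List.count_cons]
  by_cases p0 : p = 0
  · subst p0
    cases hw : w.getD 0 true <;> simp [upT, hw]
  · obtain ⟨q, rfl⟩ : ∃ q, p = q+1 := ⟨p-1, by omega⟩
    simp only [Nat.add_sub_cancel, List.getD_cons_succ] at *
    generalize List.count false (List.take (q+1) w) = cf at *
    generalize List.count true (List.take (q+1) w) = ct at *
    replace hF := hF p0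
    replace hT := hT p0
    generalize w.getD (q+1) true = x at *
    generalize w.getD q true = y at *
    clear hp p0
    cases x <;> cases y <;>
      simp [upT] at * <;> (repeat' apply And.intro) <;> (try split_ifs) <;> omega

theorem chordAt_false {w : List Bool} {p : ℕ} (hp : p < w.length) :
    chordAt (false :: w) (p+1) = (upF (chordAt w p).1, upF (chordAt w p).2) := by
  have hF := fun h0 => count_pos_take (w := w) (p := p) (b := false) h0 hp
  have hT := fun h0 => count_pos_take (w := w) (p := p) (b := true) h0 hp
  unfold chordAt
  simp only [List.take_succ_cons, List.getD_cons_succ, List.count_cons]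
  by_cases p0 : p = 0
  · subst p0
    cases hw : w.getD 0 true <;> simp [upF, hw]
  · obtain ⟨q, rfl⟩ : ∃ q, p = q+1 := ⟨p-1, by omega⟩
    simp only [Nat.add_sub_cancel, List.getD_cons_succ] at *
    generalize List.count false (List.take (q+1) w) = cf at *
    generalize List.count true (List.take (q+1) w) = ct at *
    replace hF := hF p0
    replace hT := hT p0
    generalize w.getD (q+1) true = x at *
    generalize w.getD q true = y at *
    clear hp p0
    cases x <;> cases y <;>
      simp [upF] at * <;> (repeat' apply And.intro) <;> (try split_ifs) <;> omega

theorem toPt_nonneg {m : ℕ} {x : ℤ} (h : 0 ≤ x) (h' : x < 2*(m:ℤ)+2) : toPt m x = x.toNat := by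
  unfold toPt
  rw [Int.emod_eq_of_lt h h']

theorem toPt_neg {m : ℕ} {x : ℤ} (h : x < 0) (h' : -(2*(m:ℤ)+2) ≤ x) :
    toPt m x = (x + (2*(m:ℤ)+2)).toNat := by
  unfold toPt
  rw [← Int.add_emod_right, Int.emod_eq_of_lt (by omega) (by omega)]

def sF (m j : ℕ) : ℕ := if j = 0 then 2*m+2 else j

theorem toPt_upT {m : ℕ} {x : ℤ} (h : -(2*(m:ℤ)+2) < x ∧ x < 2*(m:ℤ)+2) :
    toPt (m+1) (upT x) = toPt m x + 2 := by
  unfold upT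
  split_ifs with hx
  · rw [toPt_neg hx (by push_cast; omega), toPt_neg hx h.1.le]; push_cast; omega
  · rw [toPt_nonneg (by omega) (by push_cast; omega), toPt_nonneg (by omega) h.2]; omega

theorem toPt_upF {m : ℕ} {x : ℤ} (h : -(2*(m:ℤ)+2) < x ∧ x < 2*(m:ℤ)+2) :
    toPt (m+1) (upF x) = sF m (toPt m x) := by
  unfold upF sF
  split_ifs with hx hy hy
  · rw [toPt_nonneg (by omega) h.2] at hy; omega
  · rw [toPt_nonneg (by omega) (by push_cast; omega), toPt_nonneg (by omega) h.2]
  · rw [toPt_neg (by omega) (by push_cast; omega)]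
    rcases lt_or_eq_of_le (not_lt.1 hx) with h0 | h0
    · rw [toPt_neg h0 (by omega)] at hy; omega
    · rw [h0]; push_cast; omega
  · rw [toPt_neg (by omega) (by push_cast; omega)]
    rcases lt_or_eq_of_le (not_lt.1 hx) with h0 | h0
    · rw [toPt_neg h0 (by omega)]; push_cast; omega
    · rw [h0] at hy; simp [toPt] at hy

end CDx

namespace CDx

theorem final_true {w : List Bool} (hw : w ≠ []) :
    finalChord (true :: w) = ((finalChord w).1 + 2, (finalChord w).2 + 2) := by
  have hc := count_tf w
  have e : (true :: w).getLast? = w.getLast? := by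
    cases w with
    | nil => exact absurd rfl hw
    | cons b w => simp [List.getLast?_cons_cons]
  unfold finalChord
  rw [e]
  cases hl : w.getLast? with
  | none => exact absurd (List.getLast?_eq_none_iff.1 hl) hw
  | some b =>
    have hm := List.count_pos_iff.2 (List.mem_of_getLast? hl)
    have l : (true :: w).length = w.length + 1 := rfl
    have c : (true :: w).count true = w.count true + 1 := by simp
    cases b
    · simp only [l, c]
      rw [← toPt_upT (by omega), ← toPt_upT (by omega)]
      unfold upT
      rw [if_neg (by omega), if_neg (by omega)]
      push_cast
      congr 2
    · simp only [l, c]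
      rw [← toPt_upT (by omega), ← toPt_upT (by omega)]
      unfold upT
      rw [if_neg (by omega), if_neg (by omega)]
      push_cast
      congr 2

theorem final_false {w : List Bool} (hw : w ≠ []) :
    finalChord (false :: w) = (sF w.length (finalChord w).1, sF w.length (finalChord w).2) := by
  have hc := count_tf w
  have e : (false :: w).getLast? = w.getLast? := by
    cases w with
    | nil => exact absurd rfl hw
    | cons b w => simp [List.getLast?_cons_cons]
  unfold finalChord
  rw [e]
  cases hl : w.getLast? with
  | none => exact absurd (List.getLast?_eq_none_iff.1 hl) hw
  | some b =>
    have hm := List.count_pos_iff.2 (List.mem_of_getLast? hl)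
    have l : (false :: w).length = w.length + 1 := rfl
    have c : (false :: w).count true = w.count true := by simp
    cases b
    · simp only [l, c]
      rw [← toPt_upF (by omega), ← toPt_upF (by omega)]
      unfold upF
      rw [if_pos (by omega), if_pos (by omega)]
    · simp only [l, c]
      rw [← toPt_upF (by omega), ← toPt_upF (by omega)]
      unfold upF
      rw [if_pos (by omega), if_pos (by omega)]

theorem pairs_true {w : List Bool} (hw : w ≠ []) :
    gammaPairs (true :: w) = (0, 1) :: (gammaPairs w).map (fun pr => (pr.1 + 2, pr.2 + 2)) := by
  unfold gammaPairs
  rw [List.length_cons, List.range_succ_eq_map, List.map_cons, List.map_append, List.map_map,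
    List.map_map, List.map_singleton, final_true hw, List.cons_append]
  refine congrArg₂ List.cons ?_ ?_
  · have : chordAt (true :: w) 0 = (0, 1) := by simp [chordAt]
    rw [this]
    simp only
    rw [toPt_nonneg (by omega) (by push_cast; omega), toPt_nonneg (by omega) (by push_cast; omega)]
    rfl
  · congr 1
    apply List.map_congr_left
    intro p hp
    have hp := List.mem_range.1 hp
    have r := chordAt_range hp
    simp only [Function.comp]
    rw [chordAt_true hp]
    simp only
    rw [toPt_upT r.1, toPt_upT r.2]

theorem pairs_false {w : List Bool} (hw : w ≠ []) :
    gammaPairs (false :: w) = (2*w.length+3, 0) ::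
      (gammaPairs w).map (fun pr => (sF w.length pr.1, sF w.length pr.2)) := by
  unfold gammaPairs
  rw [List.length_cons, List.range_succ_eq_map, List.map_cons, List.map_append, List.map_map,
    List.map_map, List.map_singleton, final_false hw, List.cons_append]
  refine congrArg₂ List.cons ?_ ?_
  · have : chordAt (false :: w) 0 = (-1, 0) := by simp [chordAt]
    rw [this]
    simp only
    rw [toPt_neg (by omega) (by push_cast; omega), toPt_nonneg (by omega) (by push_cast; omega)]
    push_cast
    congr 1
    omega
  · congr 1
    apply List.map_congr_left
    intro p hp
    have hp := List.mem_range.1 hp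
    have r := chordAt_range hp
    simp only [Function.comp]
    rw [chordAt_false hp]
    simp only
    rw [toPt_upF r.1, toPt_upF r.2]

theorem good_P {n : ℕ} {L : List (ℕ × ℕ)} {g : ℕ → ℕ} (h : Good n L g) :
    Good (n+1) ((0, 1) :: L.map (fun pr => (pr.1 + 2, pr.2 + 2))) (P g) := by
  refine Good.map (τ := fun j => j + 2) h ?_ ?_ (by omega) (by omega) rfl rfl ?_ ?_
  · intro j hj; omega
  · intro j hj; simp [P]
  · intro a ha
    by_cases h0 : a = 0
    · exact Or.inl h0
    by_cases h1 : a = 1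
    · exact Or.inr (Or.inl h1)
    · exact Or.inr (Or.inr ⟨a-2, by omega, by omega⟩)
  · intro a ha
    have := h.2.2 (a-2) (by omega)
    simp only [P]
    rw [if_neg (by omega), if_neg (by omega), this]; omega

theorem good_N {m : ℕ} {L : List (ℕ × ℕ)} {g : ℕ → ℕ} (h : Good (m+1) L g) (hg : IsCD (m+1) g) :
    Good (m+2) ((2*m+3, 0) :: L.map (fun pr => (sF m pr.1, sF m pr.2)))
      (S (m+2) (P (S (m+1) g))) := by
  refine Good.map (τ := sF m) h ?_ ?_ (by omega) (by omega) ?_ ?_ ?_ ?_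
  · intro j hj; simp only [sF]; split_ifs <;> omega
  · intro j hj
    have k := cd_lt hg hj
    by_cases j0 : j = 0
    · subst j0
      have k0 := cd_ne hg hj
      have e : 2*(m+2) - (2*m+2) - 2 = 0 := by omega
      have e1 : 2*m+2 < 2*(m+2) := by omega
      have e2 : ¬ (2*m+2 = 0) := by omega
      have e3 : ¬ (2*(m+2) - (2*m+2) = 0) := by omega
      have e4 : ¬ (2*(m+2) - (2*m+2) = 1) := by omega
      simp only [sF, S, P, sg, if_true, if_pos e1, if_neg e2, if_neg e3, if_neg e4, e, if_pos hj]
      split_ifs <;> first | omega | contradiction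
    · have e1 : j < 2*(m+2) := by omega
      have e3 : ¬ (2*(m+2) - j = 0) := by omega
      have e4 : ¬ (2*(m+2) - j = 1) := by omega
      have e5 : 2*(m+2) - j - 2 < 2*(m+1) := by omega
      have e6 : ¬ (2*(m+2) - j - 2 = 0) := by omega
      have e7 : 2*(m+1) - (2*(m+2) - j - 2) = j := by omega
      simp only [sF, S, P, sg, if_neg j0, if_pos e1, if_neg e3, if_neg e4, if_pos e5, if_neg e6, e7]
      split_ifs <;> first | omega | contradiction
  · have e1 : 2*m+3 < 2*(m+2) := by omega
    have e2 : ¬ (2*m+3 = 0) := by omega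
    have e3 : 2*(m+2) - (2*m+3) = 1 := by omega
    simp [S, P, sg, e3, e1]
  · have e1 : 0 < 2*(m+2) := by omega
    simp only [S, P, sg, if_pos e1, if_true]
    rw [if_neg (by omega)]; omega
  · intro a ha
    by_cases h0 : a = 0
    · exact Or.inr (Or.inl h0)
    by_cases h1 : a = 2*m+3
    · exact Or.inl h1
    by_cases h2 : a = 2*m+2
    · exact Or.inr (Or.inr ⟨0, by omega, by simp [sF, h2]⟩)
    · exact Or.inr (Or.inr ⟨a, by omega, by simp [sF, h0]⟩)
  · intro a ha
    simp only [S]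
    rw [if_neg ha]

theorem good_nil : Good 1 [(0, 1)] f01 := by
  refine ⟨?_, ?_, ?_⟩
  · simp [f01]
  · intro a ha
    refine ⟨_, List.mem_singleton.2 rfl, ?_⟩
    simp only; omega
  · intro a ha
    simp only [f01]
    split_ifs <;> omega

theorem good_nil' : Good 1 [(1, 0)] f01 := by
  refine ⟨?_, ?_, ?_⟩
  · simp [f01]
  · intro a ha
    refine ⟨_, List.mem_singleton.2 rfl, ?_⟩
    simp only; omega
  · intro a ha
    simp only [f01]
    split_ifs <;> omega

theorem good_G (w : List Bool) : Good (w.length+1) (gammaPairs w) (G w) := by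
  induction w with
  | nil => exact good_nil
  | cons b w ih =>
    by_cases hw : w = []
    · subst hw
      cases b
      · exact good_N good_nil' f01_cd
      · exact good_P good_nil
    · cases b
      · rw [pairs_false hw]
        exact good_N ih (G_cd w)
      · rw [pairs_true hw]
        exact good_P ih

theorem gammaWord_eq (w : List Bool) : gammaWord w = G w := (good_G w).eq

/-! counting words -/

def Wl : ℕ → ℕ → Finset (List Bool)
  | 0, 0 => {[]}
  | 0, (np+1) => (Wl 0 np).map ⟨List.cons true, List.cons_injective⟩
  | (nm+1), 0 => (Wl nm 0).map ⟨List.cons false, List.cons_injective⟩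
  | (nm+1), (np+1) => (Wl nm (np+1)).map ⟨List.cons false, List.cons_injective⟩ ∪
      (Wl (nm+1) np).map ⟨List.cons true, List.cons_injective⟩

theorem Wl_mem (nm np : ℕ) (w : List Bool) : w ∈ Wl nm np ↔ memW nm np w := by
  induction w generalizing nm np with
  | nil => cases nm <;> cases np <;> simp [Wl, memW]
  | cons b w ih =>
    cases nm <;> cases np <;> cases b <;> simp [Wl, memW, ih]

theorem Wl_card (nm np : ℕ) : (Wl nm np).card = (nm+np).choose np := by
  fun_induction Wl nm np with
  | case1 => rfl
  | case2 np ih => simp [ih]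
  | case3 nm ih => simp [ih]
  | case4 nm np ih1 ih2 =>
    rw [Finset.card_union_of_disjoint, Finset.card_map, Finset.card_map, ih1, ih2]
    have : nm.succ + np.succ = (nm + (np+1)) + 1 := by omega
    rw [this, Nat.choose_succ_succ, add_comm]
    · congr 2
      ring
    · rw [Finset.disjoint_left]
      intro a h1 h2
      obtain ⟨x, _, rfl⟩ := Finset.mem_map.1 h1
      obtain ⟨y, _, h⟩ := Finset.mem_map.1 h2
      simp at h

theorem main (nm np : ℕ) :
    LinearIndependent (ZMod 2)
      (fun w : {w : List Bool // memW nm np w} =>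
        (bypassSub (nm+np+1)).mkQ (Finsupp.single (gammaWord w.1) (1 : ZMod 2)))
    ∧ Submodule.span (ZMod 2)
        (Set.range (fun w : {w : List Bool // memW nm np w} =>
          (bypassSub (nm+np+1)).mkQ (Finsupp.single (gammaWord w.1) (1 : ZMod 2))))
      = Submodule.span (ZMod 2)
        {x | ∃ f, IsCD (nm+np+1) f ∧ eulerClass (nm+np+1) f = (np : ℤ) - (nm : ℤ) ∧
          x = (bypassSub (nm+np+1)).mkQ (Finsupp.single f 1)}
    ∧ Module.finrank (ZMod 2)
        (Submodule.span (ZMod 2)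
          {x | ∃ f, IsCD (nm+np+1) f ∧ eulerClass (nm+np+1) f = (np : ℤ) - (nm : ℤ) ∧
            x = (bypassSub (nm+np+1)).mkQ (Finsupp.single f 1)})
      = (nm+np).choose np := by
  have hlen : ∀ w, memW nm np w → w.length = nm + np := by
    intro w hw
    have := count_tf w
    have := hw.1
    have := hw.2
    omega
  have hli : LinearIndependent (ZMod 2)
      (fun w : {w : List Bool // memW nm np w} =>
        (bypassSub (nm+np+1)).mkQ (Finsupp.single (gammaWord w.1) (1 : ZMod 2))) := by
    rw [linearIndependent_iff']
    intro s c hs i hi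
    obtain ⟨φ, hφ⟩ := exists_dual (nm+np) i.1 (hlen _ i.2)
    have h := congrArg φ hs
    rw [map_sum, map_zero] at h
    rw [Finset.sum_eq_single i] at h
    · rw [map_smul, gammaWord_eq] at h
      have := hφ i.1 (hlen _ i.2)
      unfold cls at this
      rw [this] at h
      simpa using h
    · intro j _ hj
      rw [map_smul, gammaWord_eq]
      have := hφ j.1 (hlen _ j.2)
      unfold cls at this
      rw [this, if_neg (fun h => hj (Subtype.ext h)), smul_zero]
    · intro h; exact absurd hi h
  have hsp : Submodule.span (ZMod 2)
        (Set.range (fun w : {w : List Bool // memW nm np w} =>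
          (bypassSub (nm+np+1)).mkQ (Finsupp.single (gammaWord w.1) (1 : ZMod 2))))
      = Submodule.span (ZMod 2)
        {x | ∃ f, IsCD (nm+np+1) f ∧ eulerClass (nm+np+1) f = (np : ℤ) - (nm : ℤ) ∧
          x = (bypassSub (nm+np+1)).mkQ (Finsupp.single f 1)} := by
    apply le_antisymm
    · rw [Submodule.span_le]
      rintro x ⟨w, rfl⟩
      apply Submodule.subset_span
      have h1 := G_cd w.1
      have h2 := euler_G w.1
      rw [hlen _ w.2] at h1 h2
      refine ⟨G w.1, h1, ?_, ?_⟩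
      · rw [h2, ew, w.2.1, w.2.2]
      · simp only [gammaWord_eq]
    · rw [Submodule.span_le]
      rintro x ⟨f, hf, he, rfl⟩
      have := span_aux (nm+np) f hf
      refine Submodule.span_mono ?_ this
      rintro y ⟨w, hw, hew, rfl⟩
      have hc := count_tf w
      rw [he, ew] at hew
      refine ⟨⟨w, by constructor <;> omega⟩, ?_⟩
      simp only [gammaWord_eq]
      rfl
  refine ⟨hli, hsp, ?_⟩
  rw [← hsp]
  have : Fintype {w : List Bool // memW nm np w} :=
    Fintype.subtype (Wl nm np) (fun w => Wl_mem nm np w)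
  rw [finrank_span_eq_card hli, ← Wl_card]
  exact Fintype.card_of_subtype _ (fun w => Wl_mem nm np w)

end CDx

theorem stmt14 (nm np : ℕ) :
    LinearIndependent (ZMod 2)
      (fun w : {w : List Bool // memW nm np w} =>
        (bypassSub (nm+np+1)).mkQ (Finsupp.single (gammaWord w.1) (1 : ZMod 2)))
    ∧ Submodule.span (ZMod 2)
        (Set.range (fun w : {w : List Bool // memW nm np w} =>
          (bypassSub (nm+np+1)).mkQ (Finsupp.single (gammaWord w.1) (1 : ZMod 2))))
      = Submodule.span (ZMod 2)
        {x | ∃ f, IsCD (nm+np+1) f ∧ eulerClass (nm+np+1) f = (np : ℤ) - (nm : ℤ) ∧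
          x = (bypassSub (nm+np+1)).mkQ (Finsupp.single f 1)}
    ∧ Module.finrank (ZMod 2)
        (Submodule.span (ZMod 2)
          {x | ∃ f, IsCD (nm+np+1) f ∧ eulerClass (nm+np+1) f = (np : ℤ) - (nm : ℤ) ∧
            x = (bypassSub (nm+np+1)).mkQ (Finsupp.single f 1)})
      = (nm+np).choose np :=
  CDx.main nm np
end

section
/- In the decomposition of any chord diagram Γ of n+1 chords and euler class e as a sum of basis elements v_w (w ∈ W(n_-, n_+)) in SFH_comb, if Γ is not itself a basis diagram then the number of basis elements appearing in its decomposition is even. -/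
set_option linter.unusedSimpArgs false

namespace Aux16

/-! ### Abstract three-cycle lemma -/

/-- Every subset containing `x` and closed under `s` is everything. -/
def Tb {α : Type*} (s : α → α) (x : α) : Prop :=
  ∀ A : Set α, x ∈ A → (∀ v ∈ A, s v ∈ A) → ∀ v, v ∈ A

lemma Tb_base {α : Type*} [Finite α] {s : α → α} (hs : Function.Injective s) {x y : α}
    (h : Tb s x) : Tb s y := by
  intro A hy hA
  by_cases hx : x ∈ A
  · exact h A hx hA
  · exfalso
    have hbij : Set.BijOn s A A := by
      have hm : Set.MapsTo s A A := fun v hv => hA v hv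
      refine ⟨hm, hs.injOn, ?_⟩
      have := Set.eq_of_subset_of_ncard_le (Set.image_subset_iff.2 hm)
        (Set.ncard_image_of_injective A hs).ge (Set.toFinite A)
      exact this.ge
    exact h Aᶜ hx (fun v hv hv' => by
      obtain ⟨u, hu, huv⟩ := hbij.2.2 hv'
      exact hv (hs huv ▸ hu)) y hy

lemma Tb_idx {α : Type*} {a : α → α} {x : α} (h : Tb a x) :
    ∃ idx : α → ℕ, Function.Injective idx ∧ idx x = 0 ∧
      ∀ v, v ≠ x → ∃ u, a u = v ∧ idx u + 1 = idx v := by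
  classical
  have hex : ∀ v, ∃ k, a^[k] x = v := by
    apply h {v | ∃ k, a^[k] x = v}
    · exact ⟨0, rfl⟩
    · rintro v ⟨k, rfl⟩
      exact ⟨k+1, Function.iterate_succ_apply' a k x⟩
  refine ⟨fun v => Nat.find (hex v), ?_, ?_, ?_⟩
  · intro u v huv
    have h1 := Nat.find_spec (hex u)
    have h2 := Nat.find_spec (hex v)
    simp only at huv
    rw [huv] at h1
    exact h1.symm.trans h2
  · exact (Nat.find_eq_zero _).2 rfl
  · intro v hv
    have h2 := Nat.find_spec (hex v)
    have hne : Nat.find (hex v) ≠ 0 := by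
      intro h0
      rw [h0] at h2
      exact hv h2.symm
    obtain ⟨k, hk⟩ := Nat.exists_eq_succ_of_ne_zero hne
    rw [hk, Function.iterate_succ_apply'] at h2
    refine ⟨a^[k] x, h2, ?_⟩
    have hle : Nat.find (hex (a^[k] x)) ≤ k := Nat.find_min' _ rfl
    have hge : Nat.find (hex v) ≤ Nat.find (hex (a^[k] x)) + 1 := by
      apply Nat.find_min'
      rw [Function.iterate_succ_apply', Nat.find_spec (hex (a^[k] x)), h2]
    simp only
    omega

/-- The relation between three maps differing by a three-cycle. -/
structure Tri {α : Type*} (a b c : α → α) (x y z : α) : Prop where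
  xy : x ≠ y
  yz : y ≠ z
  xz : x ≠ z
  off : ∀ v, v ≠ x → v ≠ y → v ≠ z → b v = a v ∧ c v = a v
  bx : b x = a y
  byz : b y = a z
  bz : b z = a x
  cx : c x = a z
  cy : c y = a x
  cz : c z = a y

lemma tri_order {α : Type*} {a b c : α → α} {x y z : α} (ha : Function.Injective a)
    (t : Tri a b c x y z) (idx : α → ℕ) (hinj : Function.Injective idx) (h0 : idx x = 0)
    (hp : ∀ v, v ≠ x → ∃ u, a u = v ∧ idx u + 1 = idx v) (hij : idx y < idx z) :
    Tb b x ∧ ¬ Tb c x := by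
  have hpos : ∀ v, v ≠ x → 0 < idx v := by
    intro v hv
    obtain ⟨u, _, h⟩ := hp v hv
    omega
  constructor
  · intro A hx hA
    have c1 : ∀ k v, idx v = k → idx y < k → k ≤ idx z → v ∈ A := by
      intro k
      induction k using Nat.strong_induction_on with
      | _ k ih =>
        intro v hv h1 h2
        have hvx : v ≠ x := by rintro rfl; omega
        obtain ⟨u, hu, hk⟩ := hp v hvx
        by_cases hy : idx u = idx y
        · have := hinj hy
          subst this
          rw [← hu, ← t.bx]
          exact hA _ hx
        · have hm := ih (idx u) (by omega) u rfl (by omega) (by omega)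
          have := (t.off u (by rintro rfl; omega) (by rintro rfl; omega) (by rintro rfl; omega)).1
          rw [← hu, ← this]
          exact hA _ hm
    have hz : z ∈ A := c1 _ z rfl hij le_rfl
    have c2 : ∀ k v, idx v = k → 0 < k → k ≤ idx y → v ∈ A := by
      intro k
      induction k using Nat.strong_induction_on with
      | _ k ih =>
        intro v hv h1 h2
        have hvx : v ≠ x := by rintro rfl; omega
        obtain ⟨u, hu, hk⟩ := hp v hvx
        by_cases hy : idx u = idx x
        · have := hinj hy
          subst this
          rw [← hu, ← t.bz]
          exact hA _ hz
        · have hm := ih (idx u) (by omega) u rfl (by omega) (by omega)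
          have := (t.off u (by rintro rfl; omega) (by rintro rfl; omega) (by rintro rfl; omega)).1
          rw [← hu, ← this]
          exact hA _ hm
    have hy : y ∈ A := c2 _ y rfl (hpos y t.xy.symm) le_rfl
    have c3 : ∀ k v, idx v = k → idx z < k → v ∈ A := by
      intro k
      induction k using Nat.strong_induction_on with
      | _ k ih =>
        intro v hv h1
        have hvx : v ≠ x := by rintro rfl; omega
        obtain ⟨u, hu, hk⟩ := hp v hvx
        by_cases hy' : idx u = idx z
        · have := hinj hy'
          subst this
          rw [← hu, ← t.byz]
          exact hA _ hy
        · have hm := ih (idx u) (by omega) u rfl (by omega)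
          have := (t.off u (by rintro rfl; omega) (by rintro rfl; omega) (by rintro rfl; omega)).1
          rw [← hu, ← this]
          exact hA _ hm
    intro v
    by_cases hv : v = x
    · exact hv ▸ hx
    · have := hpos v hv
      rcases lt_or_ge (idx z) (idx v) with h | h
      · exact c3 _ v rfl h
      · rcases lt_or_ge (idx y) (idx v) with h' | h'
        · exact c1 _ v rfl h' h
        · exact c2 _ v rfl this h'
  · intro hT
    have hnext : ∀ u, a u = x ∨ idx (a u) = idx u + 1 := by
      intro u
      by_cases h : a u = x
      · exact Or.inl h
      · obtain ⟨u', h1, h2⟩ := hp _ h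
        have := ha h1
        subst this
        exact Or.inr h2.symm
    have := hT {v | v = x ∨ idx y < idx v} (Or.inl rfl) (by
      rintro v hv
      simp only [Set.mem_ofPred_eq] at hv ⊢
      by_cases h1 : v = x
      · subst h1
        rw [t.cx]
        rcases hnext z with h | h
        · exact Or.inl h
        · right; omega
      · have hv' : idx y < idx v := hv.resolve_left h1
        by_cases h2 : v = z
        · subst h2
          rw [t.cz]
          rcases hnext y with h | h
          · exact Or.inl h
          · right; omega
        · rw [(t.off v h1 (by rintro rfl; omega) h2).2]
          rcases hnext v with h | h
          · exact Or.inl h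
          · right; omega) y
    simp only [Set.mem_ofPred_eq] at this
    rcases this with h | h
    · exact t.xy h.symm
    · omega

lemma tri_main {α : Type*} {a b c : α → α} {x y z : α} (ha : Function.Injective a)
    (t : Tri a b c x y z) (h : Tb a x) : Tb b x ↔ ¬ Tb c x := by
  obtain ⟨idx, hinj, h0, hp⟩ := Tb_idx h
  rcases lt_trichotomy (idx y) (idx z) with hij | hij | hij
  · have := tri_order ha t idx hinj h0 hp hij
    tauto
  · exact absurd (hinj hij) t.yz
  · have t' : Tri a c b x z y :=
      ⟨t.xz, t.yz.symm, t.xy, fun v h1 h2 h3 => (t.off v h1 h3 h2).symm,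
        t.cx, t.cz, t.cy, t.bx, t.bz, t.byz⟩
    have := tri_order ha t' idx hinj h0 hp hij
    tauto

lemma tri_rot {α : Type*} {a b c : α → α} {x y z : α} (t : Tri a b c x y z) :
    Tri b c a x y z :=
  ⟨t.xy, t.yz, t.xz, fun v h1 h2 h3 => by
      have := t.off v h1 h2 h3
      exact ⟨this.2.trans this.1.symm, this.1.symm⟩,
    t.cx.trans t.byz.symm, t.cy.trans t.bz.symm, t.cz.trans t.bx.symm,
    t.bz.symm, t.bx.symm, t.byz.symm⟩

open Classical in
lemma tri_sum {α : Type*} {a b c : α → α} {x y z : α} (ha : Function.Injective a)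
    (hb : Function.Injective b) (hc : Function.Injective c) (t : Tri a b c x y z) :
    (if Tb a x then (1 : ZMod 2) else 0) + (if Tb b x then 1 else 0)
      + (if Tb c x then 1 else 0) = 0 := by
  have h1 := tri_main ha t
  have h2 := tri_main hb (tri_rot t)
  have h3 := tri_main hc (tri_rot (tri_rot t))
  by_cases A : Tb a x <;> by_cases B : Tb b x <;> by_cases C : Tb c x <;>
    simp [A, B, C] at h1 h2 h3 ⊢ <;> decide

/-! ### Parity for chord diagrams -/

lemma cd_parity_lt {n : ℕ} {f : ℕ → ℕ} (hf : IsCD n f) {i : ℕ} (hi : i < 2*n) (hlt : i < f i) :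
    (i + f i) % 2 = 1 := by
  obtain ⟨⟨h1, h2, h3, h4⟩, h5⟩ := hf
  have hin : ∀ j, i < j → j < f i → i < f j ∧ f j < f i := by
    intro j hj1 hj2
    have hfi := h1 i hi
    have hj : j < 2*n := by omega
    have a1 := h5 i j hi hj
    have a2 := h5 (f j) i (h1 j hj) hi
    rw [h2 j hj] at a2
    have a3 : f j ≠ i := by
      intro h
      have := h2 j hj
      rw [h] at this
      omega
    have a4 : f j ≠ f i := by
      intro h
      have := h2 j hj
      rw [h, h2 i hi] at this
      omega
    omega
  have hsum : ∑ j ∈ Finset.Ioo i (f i), (1 : ZMod 2) = 0 := by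
    have hfi := h1 i hi
    refine Finset.sum_involution (fun j _ => f j) ?_ ?_ ?_ ?_
    · intros; decide
    · intro j hj _
      rw [Finset.mem_Ioo] at hj
      exact h3 j (by omega)
    · intro j hj
      rw [Finset.mem_Ioo] at hj ⊢
      exact hin j hj.1 hj.2
    · intro j hj
      rw [Finset.mem_Ioo] at hj
      exact h2 j (by omega)
  rw [Finset.sum_const, Nat.card_Ioo, nsmul_eq_mul, mul_one, ZMod.natCast_eq_zero_iff] at hsum
  omega

lemma cd_parity {n : ℕ} {f : ℕ → ℕ} (hf : IsCD n f) {i : ℕ} (hi : i < 2*n) :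
    (i + f i) % 2 = 1 := by
  rcases lt_trichotomy i (f i) with h | h | h
  · exact cd_parity_lt hf hi h
  · exact absurd h.symm (hf.1.2.2.1 i hi)
  · have := cd_parity_lt hf (hf.1.1 i hi) (by rw [hf.1.2.1 i hi]; exact h)
    rw [hf.1.2.1 i hi] at this
    omega

/-! ### The pairing functional -/

/-- The (shifted) minimal matching, on odd points. -/
def M (np j : ℕ) : ℕ := if j = 2*np+1 then 0 else if j < 2*np+1 then j+1 else j-1

/-- The glued curve is connected. -/
def T (np n : ℕ) (f : ℕ → ℕ) : Prop :=
  ∀ A : Set ℕ, 0 ∈ A → (∀ i ∈ A, i < 2*n → Even i → M np (f i) ∈ A) →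
    ∀ i, i < 2*n → Even i → i ∈ A

/-- Even marked points. -/
abbrev Ev (n : ℕ) := {i : ℕ // i < 2*n ∧ Even i}

instance (n : ℕ) : Finite (Ev n) :=
  Set.Finite.to_subtype ((Set.finite_lt_nat (2*n)).subset (fun _ h => h.1))

lemma sg_mem {np n : ℕ} (hn : np < n) {f : ℕ → ℕ} (hf : IsCD n f) (i : Ev n) :
    M np (f i) < 2*n ∧ Even (M np (f i)) := by
  obtain ⟨i, hi, he⟩ := i
  have h1 := cd_parity hf hi
  have h2 := hf.1.1 i hi
  simp only [M]
  rw [Nat.even_iff] at he ⊢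
  split_ifs <;> omega

/-- The permutation of even points. -/
def sg {np n : ℕ} (hn : np < n) {f : ℕ → ℕ} (hf : IsCD n f) (i : Ev n) : Ev n :=
  ⟨M np (f i), sg_mem hn hf i⟩

lemma sg_inj {np n : ℕ} (hn : np < n) {f : ℕ → ℕ} (hf : IsCD n f) :
    Function.Injective (sg hn hf) := by
  rintro ⟨i, hi, hie⟩ ⟨j, hj, hje⟩ h
  have h : M np (f i) = M np (f j) := congrArg Subtype.val h
  have h1 := cd_parity hf hi
  have h2 := cd_parity hf hj
  rw [Nat.even_iff] at hie hje
  have : f i = f j := by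
    unfold M at h
    split_ifs at h <;> omega
  have h' : f (f i) = f (f j) := congrArg f this
  rw [hf.1.2.1 i hi, hf.1.2.1 j hj] at h'
  exact Subtype.ext h'

lemma T_iff {np n : ℕ} (hn : np < n) {f : ℕ → ℕ} (hf : IsCD n f) (x : Ev n) :
    T np n f ↔ Tb (sg hn hf) x := by
  constructor
  · intro h
    apply Tb_base (sg_inj hn hf) (x := ⟨0, by omega, Even.zero⟩)
    intro A h0 hA
    have := h {i | ∃ hi, (⟨i, hi⟩ : Ev n) ∈ A} ⟨_, h0⟩ (by
      rintro i ⟨hi, hiA⟩ _ _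
      exact ⟨_, hA _ hiA⟩)
    rintro ⟨v, hv1, hv2⟩
    exact (this v hv1 hv2).2
  · intro h
    have h := Tb_base (sg_inj hn hf) (y := ⟨0, by omega, Even.zero⟩) h
    intro A h0 hA i hi he
    exact h {i | i.1 ∈ A} h0 (fun v hv => hA v.1 hv v.2.1 v.2.2) ⟨i, hi, he⟩

lemma tri_of {np n : ℕ} (hn : np < n) {f g h : ℕ → ℕ} (hf : IsCD n f) (hg : IsCD n g)
    (hh : IsCD n h) (x y z : Ev n) (xy : x.1 ≠ y.1) (yz : y.1 ≠ z.1) (xz : x.1 ≠ z.1)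
    (off : ∀ v, v < 2*n → Even v → v ≠ x.1 → v ≠ y.1 → v ≠ z.1 → f v = g v ∧ f v = h v)
    (bx : g x = f y) (hby : g y = f z) (bz : g z = f x)
    (cx : h x = f z) (cy : h y = f x) (cz : h z = f y) :
    Tri (sg hn hf) (sg hn hg) (sg hn hh) x y z := by
  refine ⟨fun h => xy (by rw [h]), fun h => yz (by rw [h]), fun h => xz (by rw [h]),
    ?_, ?_, ?_, ?_, ?_, ?_, ?_⟩
  · intro v h1 h2 h3
    have := off v.1 v.2.1 v.2.2 (fun h => h1 (Subtype.ext h)) (fun h => h2 (Subtype.ext h))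
      (fun h => h3 (Subtype.ext h))
    constructor <;> apply Subtype.ext <;> simp only [sg]
    · rw [this.1]
    · rw [this.2]
  all_goals (apply Subtype.ext; simp only [sg, bx, hby, bz, cx, cy, cz])

lemma bypass_tri {np n : ℕ} (hn : np < n) {f g h : ℕ → ℕ} (hb : BypassRel n f g h) :
    ∃ (hf : IsCD n f) (hg : IsCD n g) (hh : IsCD n h) (x y z : Ev n),
      Tri (sg hn hf) (sg hn hg) (sg hn hh) x y z := by
  obtain ⟨hf, hg, hh, q, hq, hlt, hoff, f0, f1, f2, g0, g2, g3, h0, h1, h4⟩ := hb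
  refine ⟨hf, hg, hh, ?_⟩
  have f5 : f (q 5) = q 0 := by rw [← f0, hf.1.2.1 _ (hlt _)]
  have f4 : f (q 4) = q 1 := by rw [← f1, hf.1.2.1 _ (hlt _)]
  have f3 : f (q 3) = q 2 := by rw [← f2, hf.1.2.1 _ (hlt _)]
  have g1 : g (q 1) = q 0 := by rw [← g0, hg.1.2.1 _ (hlt _)]
  have g5 : g (q 5) = q 2 := by rw [← g2, hg.1.2.1 _ (hlt _)]
  have g4 : g (q 4) = q 3 := by rw [← g3, hg.1.2.1 _ (hlt _)]
  have h3 : h (q 3) = q 0 := by rw [← h0, hh.1.2.1 _ (hlt _)]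
  have h2 : h (q 2) = q 1 := by rw [← h1, hh.1.2.1 _ (hlt _)]
  have h5 : h (q 5) = q 4 := by rw [← h4, hh.1.2.1 _ (hlt _)]
  have pf0 := cd_parity hf (hlt 0)
  have pf1 := cd_parity hf (hlt 1)
  have pf2 := cd_parity hf (hlt 2)
  have pg0 := cd_parity hg (hlt 0)
  have pg2 := cd_parity hg (hlt 2)
  rw [f0] at pf0
  rw [f1] at pf1
  rw [f2] at pf2
  rw [g0] at pg0
  rw [g2] at pg2
  have l01 : q 0 < q 1 := hq (by decide)
  have l12 : q 1 < q 2 := hq (by decide)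
  have l23 : q 2 < q 3 := hq (by decide)
  have l34 : q 3 < q 4 := hq (by decide)
  have l45 : q 4 < q 5 := hq (by decide)
  rcases Nat.mod_two_eq_zero_or_one (q 0) with hpar | hpar
  · refine ⟨⟨q 0, hlt 0, by rw [Nat.even_iff]; omega⟩, ⟨q 4, hlt 4, by rw [Nat.even_iff]; omega⟩,
      ⟨q 2, hlt 2, by rw [Nat.even_iff]; omega⟩, ?_⟩
    refine tri_of hn hf hg hh _ _ _ ?_ ?_ ?_ ?_ ?_ ?_ ?_ ?_ ?_ ?_ <;> simp only
    · omega
    · omega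
    · omega
    · intro v hv he a1 a2 a3
      rw [Nat.even_iff] at he
      refine hoff v hv ?_
      intro j
      fin_cases j <;> simp <;> omega
    all_goals simp only [f0, f1, f2, f3, f4, f5, g0, g1, g2, g3, g4, g5, h0, h1, h2, h3, h4, h5]
  · refine ⟨⟨q 1, hlt 1, by rw [Nat.even_iff]; omega⟩, ⟨q 5, hlt 5, by rw [Nat.even_iff]; omega⟩,
      ⟨q 3, hlt 3, by rw [Nat.even_iff]; omega⟩, ?_⟩
    refine tri_of hn hf hg hh _ _ _ ?_ ?_ ?_ ?_ ?_ ?_ ?_ ?_ ?_ ?_ <;> simp only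
    · omega
    · omega
    · omega
    · intro v hv he a1 a2 a3
      rw [Nat.even_iff] at he
      refine hoff v hv ?_
      intro j
      fin_cases j <;> simp <;> omega
    all_goals simp only [f0, f1, f2, f3, f4, f5, g0, g1, g2, g3, g4, g5, h0, h1, h2, h3, h4, h5]

open Classical in
lemma bypass_sum {np n : ℕ} (hn : np < n) {f g h : ℕ → ℕ} (hb : BypassRel n f g h) :
    (if IsCD n f ∧ T np n f then (1 : ZMod 2) else 0) + (if IsCD n g ∧ T np n g then 1 else 0)
      + (if IsCD n h ∧ T np n h then 1 else 0) = 0 := by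
  obtain ⟨hf, hg, hh, x, y, z, t⟩ := bypass_tri hn hb
  have := tri_sum (sg_inj hn hf) (sg_inj hn hg) (sg_inj hn hh) t
  simp only [hf, hg, hh, true_and, T_iff hn hf x, T_iff hn hg x, T_iff hn hh x]
  exact this


/-! ### Insertion of a chord at the base point -/

/-- Insert a chord `(0,1)`. -/
def insP (g : ℕ → ℕ) (a : ℕ) : ℕ := if a = 0 then 1 else if a = 1 then 0 else g (a-2) + 2

/-- Relabelling. -/
def shf (m y : ℕ) : ℕ := if y = 0 then 2*m+2 else y

/-- Relabelling, inverse. -/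
def ro (m a : ℕ) : ℕ := if a = 2*m+2 then 0 else a

/-- Insert a chord `(0,-1)`. -/
def insM (m : ℕ) (g : ℕ → ℕ) (a : ℕ) : ℕ :=
  if a = 0 then 2*m+3 else if a = 2*m+3 then 0 else shf m (g (ro m a))

lemma insP_add (g : ℕ → ℕ) (i : ℕ) : insP g (i+2) = g i + 2 := by simp [insP]

lemma cd_insP {n : ℕ} {g : ℕ → ℕ} (hg : IsCD n g) : IsCD (n+1) (insP g) := by
  obtain ⟨⟨h1, h2, h3, h4⟩, h5⟩ := hg
  have hcases : ∀ i, i = 0 ∨ i = 1 ∨ ∃ k, i = k+2 := by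
    intro i
    rcases i with _ | _ | k
    · simp
    · simp
    · exact Or.inr (Or.inr ⟨k, rfl⟩)
  have e0 : insP g 0 = 1 := by simp [insP]
  have e1 : insP g 1 = 0 := by simp [insP]
  refine ⟨⟨?_, ?_, ?_, ?_⟩, ?_⟩
  · intro i hi
    rcases hcases i with rfl | rfl | ⟨k, rfl⟩
    · rw [e0]; omega
    · rw [e1]; omega
    · rw [insP_add]; have := h1 k (by omega); omega
  · intro i hi
    rcases hcases i with rfl | rfl | ⟨k, rfl⟩
    · rw [e0, e1]
    · rw [e1, e0]
    · rw [insP_add, insP_add, h2 k (by omega)]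
  · intro i hi
    rcases hcases i with rfl | rfl | ⟨k, rfl⟩
    · rw [e0]; omega
    · rw [e1]; omega
    · rw [insP_add]; have := h3 k (by omega); omega
  · intro i hi
    rcases hcases i with rfl | rfl | ⟨k, rfl⟩
    · omega
    · omega
    · rw [insP_add, h4 k (by omega)]
  · intro a b ha hb
    rcases hcases a with rfl | rfl | ⟨k, rfl⟩
    · rw [e0]; omega
    · rw [e1]; omega
    · rcases hcases b with rfl | rfl | ⟨l, rfl⟩
      · omega
      · omega
      · rw [insP_add, insP_add]
        have := h5 k l (by omega) (by omega)
        omega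

lemma insP_surj {n : ℕ} {f : ℕ → ℕ} (hf : IsCD (n+1) f) (h0 : f 0 = 1) :
    ∃ g, IsCD n g ∧ f = insP g := by
  obtain ⟨⟨h1, h2, h3, h4⟩, h5⟩ := hf
  have h01 : f 1 = 0 := by rw [← h0, h2 0 (by omega)]
  have hge : ∀ i, 2 ≤ f (i+2) := by
    intro i
    by_cases hi : i + 2 < 2*(n+1)
    · have := h2 _ hi
      by_contra hlt
      have : f (i+2) = 0 ∨ f (i+2) = 1 := by omega
      rcases this with h | h <;> rw [h] at this <;> omega
    · rw [h4 _ hi]; omega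
  refine ⟨fun i => f (i+2) - 2, ⟨⟨?_, ?_, ?_, ?_⟩, ?_⟩, ?_⟩
  · intro i hi
    have := h1 (i+2) (by omega)
    simp only; omega
  · intro i hi
    have := hge i
    simp only
    rw [Nat.sub_add_cancel this, h2 (i+2) (by omega)]; omega
  · intro i hi
    have := h3 (i+2) (by omega)
    have := hge i
    simp only; omega
  · intro i hi
    have := h4 (i+2) (by omega)
    simp only; omega
  · intro a b ha hb
    have := h5 (a+2) (b+2) (by omega) (by omega)
    have := hge a
    have := hge b
    simp only; omega
  · funext a
    rcases a with _ | _ | k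
    · simp [insP, h0]
    · simp [insP, h01]
    · rw [insP_add]
      exact (Nat.sub_add_cancel (hge k)).symm

lemma cd_insM {m : ℕ} {g : ℕ → ℕ} (hg : IsCD (m+1) g) : IsCD (m+2) (insM m g) := by
  obtain ⟨⟨h1, h2, h3, h4⟩, h5⟩ := hg
  have hr : ∀ i, 0 < i → i < 2*m+3 → ro m i < 2*(m+1) := by
    intro i _ _; unfold ro; split_ifs <;> omega
  have e0 : insM m g 0 = 2*m+3 := by simp [insM]
  have e1 : insM m g (2*m+3) = 0 := by simp [insM]
  have e : ∀ i, 0 < i → i < 2*m+3 → insM m g i = shf m (g (ro m i)) := by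
    intro i _ _; unfold insM; rw [if_neg (by omega), if_neg (by omega)]
  have hshf : ∀ y, y < 2*(m+1) → 0 < shf m y ∧ shf m y < 2*m+3 ∧ ro m (shf m y) = y := by
    intro y hy; unfold shf ro; split_ifs <;> omega
  have hoi : ∀ i, 0 < i → i < 2*m+3 → shf m (ro m i) = i := by
    intro y _ _; unfold shf ro; split_ifs <;> omega
  have key : ∀ i, i < 2*(m+2) → i = 0 ∨ i = 2*m+3 ∨ ∃ k, k < 2*(m+1) ∧ i = shf m k := by
    intro i hi
    by_cases h : i = 0
    · exact Or.inl h
    by_cases h' : i = 2*m+3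
    · exact Or.inr (Or.inl h')
    exact Or.inr (Or.inr ⟨ro m i, hr i (by omega) (by omega), (hoi i (by omega) (by omega)).symm⟩)
  have ei : ∀ k, k < 2*(m+1) → insM m g (shf m k) = shf m (g k) := by
    intro k hk
    obtain ⟨a, b, c⟩ := hshf k hk
    rw [e _ a b, c]
  refine ⟨⟨?_, ?_, ?_, ?_⟩, ?_⟩
  · intro i hi
    rcases key i hi with rfl | rfl | ⟨k, hk, rfl⟩
    · rw [e0]; omega
    · rw [e1]; omega
    · rw [ei k hk]; have := hshf _ (h1 k hk); omega
  · intro i hi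
    rcases key i hi with rfl | rfl | ⟨k, hk, rfl⟩
    · rw [e0, e1]
    · rw [e1, e0]
    · rw [ei k hk, ei _ (h1 k hk), h2 k hk]
  · intro i hi
    rcases key i hi with rfl | rfl | ⟨k, hk, rfl⟩
    · rw [e0]; omega
    · rw [e1]; omega
    · rw [ei k hk]
      intro h
      have := congrArg (ro m) h
      rw [(hshf k hk).2.2, (hshf _ (h1 k hk)).2.2] at this
      exact h3 k hk this
  · intro i hi
    have : ro m i = i := by unfold ro; split_ifs <;> omega
    unfold insM
    rw [if_neg (by omega), if_neg (by omega), this, h4 i (by omega)]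
    unfold shf; split_ifs <;> omega
  · intro a b ha hb
    rcases key a ha with rfl | rfl | ⟨k, hk, rfl⟩
    · rw [e0]
      rcases key b hb with rfl | rfl | ⟨l, hl, rfl⟩
      · omega
      · omega
      · rw [ei l hl]; have := hshf _ (h1 l hl); omega
    · rw [e1]; omega
    · rcases key b hb with rfl | rfl | ⟨l, hl, rfl⟩
      · omega
      · rw [e1]; omega
      · rw [ei k hk, ei l hl]
        have a1 := h5 k l hk hl
        have a2 := h5 0 k (by omega) hk
        have a3 := h2 k hk
        have a4 := h2 l hl
        have a5 := h1 k hk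
        have a6 := h1 l hl
        have a7 : g l = 0 → g 0 = l := by intro h; rw [← h, a4]
        unfold shf
        split_ifs <;> omega

lemma insM_surj {m : ℕ} {f : ℕ → ℕ} (hf : IsCD (m+2) f) (h0 : f 0 = 2*m+3) :
    ∃ g, IsCD (m+1) g ∧ f = insM m g := by
  obtain ⟨⟨h1, h2, h3, h4⟩, h5⟩ := hf
  have hN : f (2*m+3) = 0 := by rw [← h0, h2 0 (by omega)]
  have hin : ∀ i, 0 < i → i < 2*m+3 → 0 < f i ∧ f i < 2*m+3 := by
    intro i hi hi'
    have a1 := h1 i (by omega)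
    have a2 := h2 i (by omega)
    have a3 : f i ≠ 0 := by intro h; rw [h] at a2; omega
    have a4 : f i ≠ 2*m+3 := by intro h; rw [h] at a2; omega
    omega
  have hshf : ∀ y, y < 2*(m+1) → 0 < shf m y ∧ shf m y < 2*m+3 ∧ ro m (shf m y) = y := by
    intro y hy; unfold shf ro; split_ifs <;> omega
  have hoi : ∀ i, 0 < i → i < 2*m+3 → ro m i < 2*(m+1) ∧ shf m (ro m i) = i := by
    intro y _ _; unfold shf ro; split_ifs <;> omega
  let g : ℕ → ℕ := fun i => if i < 2*(m+1) then ro m (f (shf m i)) else i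
  have hg : ∀ i, i < 2*(m+1) → g i = ro m (f (shf m i)) := fun i hi => if_pos hi
  have hf' : ∀ i, i < 2*(m+1) → 0 < f (shf m i) ∧ f (shf m i) < 2*m+3 :=
    fun i hi => hin _ (hshf i hi).1 (hshf i hi).2.1
  have hg1 : ∀ i, i < 2*(m+1) → g i < 2*(m+1) := by
    intro i hi
    rw [hg i hi]
    exact (hoi _ (hf' i hi).1 (hf' i hi).2).1
  have hgshf : ∀ i, i < 2*(m+1) → shf m (g i) = f (shf m i) := by
    intro i hi
    rw [hg i hi]
    exact (hoi _ (hf' i hi).1 (hf' i hi).2).2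
  have hg2 : ∀ i, i < 2*(m+1) → g (g i) = i := by
    intro i hi
    rw [hg _ (hg1 i hi), hgshf i hi, h2 _ (by have := hshf i hi; omega), (hshf i hi).2.2]
  refine ⟨g, ⟨⟨hg1, hg2, ?_, ?_⟩, ?_⟩, ?_⟩
  · intro i hi h
    have := hgshf i hi
    rw [h] at this
    exact h3 _ (by have := hshf i hi; omega) this.symm
  · intro i hi
    exact if_neg hi
  · intro a b ha hb
    have a1 := h5 (shf m a) (shf m b) (by have := hshf a ha; omega) (by have := hshf b hb; omega)
    have a2 := h5 (shf m b) (shf m (g a)) (by have := hshf b hb; omega)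
      (by have := hshf _ (hg1 a ha); omega)
    rw [← hgshf a ha, ← hgshf b hb] at a1
    rw [← hgshf _ (hg1 a ha), ← hgshf b hb, hg2 a ha] at a2
    have := hg1 a ha
    have := hg1 b hb
    unfold shf at a1 a2
    split_ifs at a1 a2 <;> omega
  · funext a
    unfold insM
    by_cases ha : a = 0
    · rw [if_pos ha, ha, h0]
    · rw [if_neg ha]
      by_cases hb : a = 2*m+3
      · rw [if_pos hb, hb, hN]
      · rw [if_neg hb]
        by_cases hc : a < 2*m+3
        · obtain ⟨b1, b2⟩ := hoi a (by omega) hc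
          rw [hgshf _ b1, b2]
        · have : ro m a = a := by unfold ro; split_ifs <;> omega
          rw [this, h4 a (by omega)]
          have : g a = a := if_neg (by omega)
          rw [this]
          unfold shf; split_ifs <;> omega

/-! ### The functional under insertion -/

lemma T_insP {np n : ℕ} {g : ℕ → ℕ} :
    T (np+1) (n+1) (insP g) ↔ T np n g := by
  have hM : ∀ j, j ≠ 2*np+1 → M (np+1) (j+2) = M np j + 2 := by
    intro j hj; unfold M; split_ifs <;> omega
  have hM' : ∀ j, j = 2*np+1 → M (np+1) (j+2) = 0 ∧ M np j = 0 := by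
    intro j hj; unfold M; split_ifs <;> omega
  have h0 : M (np+1) (insP g 0) = 2 := by simp [insP, M]
  constructor
  · intro h A hA hcl i hi he
    have := h {i | i = 0 ∨ ∃ k ∈ A, i = k+2} (Or.inl rfl) (by
      rintro i (rfl | ⟨k, hk, rfl⟩) hi he
      · rw [h0]; exact Or.inr ⟨0, hA, rfl⟩
      · rw [insP_add]
        by_cases hj : g k = 2*np+1
        · exact Or.inl (hM' _ hj).1
        · rw [hM _ hj]
          refine Or.inr ⟨_, hcl k hk (by omega) ?_, rfl⟩
          rw [Nat.even_iff] at he ⊢; omega) (i+2) (by omega)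
          (by rw [Nat.even_iff] at he ⊢; omega)
    rcases this with h | ⟨k, hk, h⟩
    · omega
    · have : i = k := by omega
      rw [this]; exact hk
  · intro h A hA hcl
    have h2 : 2 ∈ A := by
      have := hcl 0 hA (by omega) Even.zero
      rwa [h0] at this
    have := h {i | i+2 ∈ A} h2 (by
      intro i hi hlt he
      have hh := hcl (i+2) hi (by omega) (by rw [Nat.even_iff] at he ⊢; omega)
      rw [insP_add] at hh
      by_cases hj : g i = 2*np+1
      · simp only [Set.mem_ofPred_eq]
        rw [(hM' _ hj).2]
        exact h2
      · rw [hM _ hj] at hh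
        exact hh)
    intro i hi he
    rcases i with _ | _ | k
    · exact hA
    · simp at he
    · exact this k (by omega) (by rw [Nat.even_iff] at he ⊢; omega)

lemma T_insM {np m : ℕ} (hn : np < m+1) {g : ℕ → ℕ} (hg : IsCD (m+1) g) :
    T np (m+2) (insM m g) ↔ T np (m+1) g := by
  have h0 : M np (insM m g 0) = 2*m+2 := by
    simp only [insM, if_true, M]; split_ifs <;> omega
  have hshf : ∀ y, y < 2*(m+1) → 0 < shf m y ∧ shf m y < 2*m+3 ∧ ro m (shf m y) = y := by
    intro y hy; unfold shf ro; split_ifs <;> omega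
  have ei : ∀ k, k < 2*(m+1) → insM m g (shf m k) = shf m (g k) := by
    intro k hk
    obtain ⟨a, b, c⟩ := hshf k hk
    unfold insM
    rw [if_neg (by omega), if_neg (by omega), c]
  have hev : ∀ k, Even (shf m k) ↔ Even k := by
    intro k; simp only [Nat.even_iff]; unfold shf; split_ifs <;> omega
  have hodd : ∀ k, k < 2*(m+1) → Even k → shf m (g k) = g k ∧ (g k) % 2 = 1 := by
    intro k hk he
    have := cd_parity hg hk
    rw [Nat.even_iff] at he
    unfold shf; split_ifs <;> omega
  have hM : ∀ j, j ≠ 2*np+1 → j % 2 = 1 → M np j = shf m (M np j) := by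
    intro j hj hj'
    have : M np j ≠ 0 := by unfold M; split_ifs <;> omega
    unfold shf; rw [if_neg this]
  have hM' : ∀ j, j = 2*np+1 → M np j = 0 := by
    intro j hj; unfold M; rw [if_pos hj]
  have hi0 : shf m 0 = 2*m+2 := by simp [shf]
  constructor
  · intro h A hA hcl i hi he
    have := h {i | i = 0 ∨ ∃ k ∈ A, k < 2*(m+1) ∧ i = shf m k} (Or.inl rfl) (by
      rintro i (rfl | ⟨k, hk, hk', rfl⟩) hi he
      · rw [h0]; exact Or.inr ⟨0, hA, by omega, hi0.symm⟩
      · rw [hev] at he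
        obtain ⟨b1, b2⟩ := hodd k hk' he
        rw [ei k hk', b1]
        by_cases hj : g k = 2*np+1
        · exact Or.inl (hM' _ hj)
        · rw [hM _ hj b2]
          refine Or.inr ⟨_, hcl k hk hk' he, ?_, rfl⟩
          have := hg.1.1 k hk'
          unfold M; split_ifs <;> omega) (shf m i) (by have := hshf i hi; omega) ((hev i).2 he)
    rcases this with h | ⟨k, hk, hk', h⟩
    · have := hshf i hi; omega
    · have := congrArg (ro m) h
      rw [(hshf i hi).2.2, (hshf k hk').2.2] at this
      rw [this]; exact hk
  · intro h A hA hcl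
    have h2 : shf m 0 ∈ A := by
      have := hcl 0 hA (by omega) Even.zero
      rwa [h0, ← hi0] at this
    have := h {i | shf m i ∈ A} h2 (by
      intro i hi hlt he
      have hh := hcl (shf m i) hi (by have := hshf i hlt; omega) ((hev i).2 he)
      obtain ⟨b1, b2⟩ := hodd i hlt he
      rw [ei i hlt, b1] at hh
      by_cases hj : g i = 2*np+1
      · simp only [Set.mem_ofPred_eq]
        rw [hM' _ hj]
        exact h2
      · rw [hM _ hj b2] at hh
        exact hh)
    intro i hi he
    by_cases hz : i = 0
    · rw [hz]; exact hA
    · rw [Nat.even_iff] at he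
      have e : shf m (ro m i) = i := by unfold shf ro; split_ifs <;> omega
      have l : ro m i < 2*(m+1) := by unfold ro; split_ifs <;> omega
      have := this (ro m i) l (by rw [Nat.even_iff]; unfold ro; split_ifs <;> omega)
      simp only [Set.mem_ofPred_eq, e] at this
      exact this

/-- If the glued curve is connected, the chord at the base point is short. -/
lemma T_zero {np n : ℕ} (hn : np < n) {f : ℕ → ℕ} (hf : IsCD n f) (hT : T np n f) :
    n = 1 ∨ (f 0 = 1 ∧ 0 < np) ∨ (f 0 = 2*n-1 ∧ np + 1 < n) := by
  have hp := cd_parity hf (i := 0) (by omega)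
  have hlt := hf.1.1 0 (by omega)
  have hne : f 0 = 2*np+1 → n = 1 := by
    intro h
    by_contra hn1
    have := hT {0} rfl (by
      rintro i rfl _ _
      simp [M, h]) 2 (by omega) (by decide)
    simp at this
  have hin : ∀ j, j < 2*n → (0 < j ∧ j < f 0 ↔ 0 < f j ∧ f j < f 0) := by
    have aux : ∀ j, j < 2*n → (0 < j ∧ j < f 0 → 0 < f j ∧ f j < f 0) := by
      intro j hj hj2
      have a1 := hf.2 0 j (by omega) hj
      have a2 := hf.1.2.1 j hj
      have a3 : f j ≠ 0 := by intro h; rw [h] at a2; omega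
      have a4 : f j ≠ f 0 := by
        intro h; rw [h, hf.1.2.1 0 (by omega)] at a2; omega
      omega
    intro j hj
    refine ⟨aux j hj, fun h => ?_⟩
    have := aux (f j) (hf.1.1 j hj) h
    rwa [hf.1.2.1 j hj] at this
  rcases lt_trichotomy (f 0) (2*np+1) with h | h | h
  · right; left
    refine ⟨?_, by omega⟩
    by_contra h1
    have := hT {i | ¬ (0 < i ∧ i < f 0)} (by simp) (by
      intro i hi hlt he
      simp only [Set.mem_ofPred_eq] at hi ⊢
      rw [hin i hlt] at hi
      have := cd_parity hf hlt
      rw [Nat.even_iff] at he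
      unfold M; split_ifs <;> omega) 2 (by omega) (by decide)
    simp only [Set.mem_ofPred_eq] at this
    omega
  · exact Or.inl (hne h)
  · right; right
    suffices f 0 = 2*n-1 by omega
    by_contra h1
    have := hT {i | i ≤ f 0} (by simp) (by
      intro i hi hlt he
      simp only [Set.mem_ofPred_eq] at hi ⊢
      have h3 := hin i hlt
      have := cd_parity hf hlt
      have h4 : f i = f 0 ∨ f i < f 0 := by
        by_cases hz : i = 0
        · left; rw [hz]
        · by_cases hz' : i = f 0
          · right; rw [hz', hf.1.2.1 0 (by omega)]; omega
          · right; omega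
      rw [Nat.even_iff] at he
      unfold M; split_ifs <;> omega) (f 0 + 1) (by omega) (by rw [Nat.even_iff]; omega)
    simp only [Set.mem_ofPred_eq] at this
    omega


/-! ### Recursion for the basis diagrams -/

lemma toPt_nonneg {m : ℕ} {x : ℤ} (h0 : 0 ≤ x) (h1 : x < 2*m+2) : toPt m x = x.toNat := by
  unfold toPt; rw [Int.emod_eq_of_lt h0 h1]

lemma toPt_neg {m : ℕ} {x : ℤ} (h0 : -(2*m+2) ≤ x) (h1 : x < 0) :
    toPt m x = (x + (2*m+2)).toNat := by
  unfold toPt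
  rw [← Int.add_emod_right, Int.emod_eq_of_lt (by omega) (by omega)]

lemma toPt_lt (m : ℕ) (x : ℤ) : toPt m x < 2*m+2 := by
  unfold toPt
  have h1 := Int.emod_nonneg x (b := 2*(m:ℤ)+2) (by omega)
  have h2 := Int.emod_lt_of_pos x (b := 2*(m:ℤ)+2) (by omega)
  omega

lemma toPt_P {m : ℕ} {x x' : ℤ} (h : (0 ≤ x ∧ x < 2*m+2 ∧ x' = x+2) ∨
    (-(2*m+2) ≤ x ∧ x < 0 ∧ x' = x)) : toPt (m+1) x' = toPt m x + 2 := by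
  rcases h with ⟨h0, h1, rfl⟩ | ⟨h0, h1, rfl⟩
  · rw [toPt_nonneg h0 h1, toPt_nonneg (by omega) (by push_cast; omega)]; omega
  · rw [toPt_neg h0 h1, toPt_neg (by push_cast; omega) h1]; push_cast; omega

lemma toPt_M {m : ℕ} {x x' : ℤ} (h : (0 < x ∧ x < 2*m+2 ∧ x' = x) ∨
    (-(2*m+2) < x ∧ x ≤ 0 ∧ x' = x-2)) : toPt (m+1) x' = shf m (toPt m x) := by
  rcases h with ⟨h0, h1, rfl⟩ | ⟨h0, h1, rfl⟩
  · rw [toPt_nonneg h0.le h1, toPt_nonneg h0.le (by push_cast; omega)]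
    unfold shf; rw [if_neg (by omega)]
  · rw [toPt_neg (x := x-2) (by push_cast; omega) (by omega)]
    rcases eq_or_lt_of_le h1 with rfl | h1
    · rw [toPt_nonneg le_rfl (by omega)]
      simp only [Int.toNat_zero, shf, if_true]; push_cast; omega
    · rw [toPt_neg (by omega) h1]
      unfold shf; rw [if_neg (by omega)]; push_cast; omega

lemma count_facts (w : List Bool) (p : ℕ) (hp : p ≤ w.length) :
    (w.take p).count false + (w.take p).count true = p := by
  have h := List.count_not_add_count (w.take p) true
  simp only [Bool.not_true, List.length_take] at h
  omega

lemma count_prev (w : List Bool) (p : ℕ) (hp : p < w.length) (b : Bool)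
    (h : w.getD p true = b) : 0 < (w.take (p+1)).count b := by
  rw [List.count_pos_iff]
  rw [List.getD_eq_getElem _ _ hp] at h
  rw [List.mem_take_iff_getElem]
  exact ⟨p, by omega, h⟩

lemma chord_P (w : List Bool) (p : ℕ) (hp : p < w.length) :
    toPt (w.length+1) (chordAt (true::w) (p+1)).1 = toPt w.length (chordAt w p).1 + 2 ∧
    toPt (w.length+1) (chordAt (true::w) (p+1)).2 = toPt w.length (chordAt w p).2 + 2 := by
  have hc := count_facts w p hp.le
  rcases p with _ | p
  · rcases hb : w.getD 0 true with _ | _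
    all_goals
      simp only [chordAt, List.getD_cons_succ, List.getD_cons_zero, hb, List.take_succ_cons,
        List.count_cons, List.take_zero, List.count_nil]
      simp only [Nat.add_eq_zero_iff, one_ne_zero, and_false, false_or, ne_eq, not_true_eq_false,
        not_false_eq_true, if_true, if_false, reduceCtorEq, beq_self_eq_true, true_or,
        Bool.beq_eq_decide_eq, decide_true, decide_false, Bool.false_eq_true, Nat.cast_add,
        Nat.cast_one, Nat.cast_zero, add_zero, zero_add, or_true, or_self, Nat.sub_self,
        List.getD_cons_zero]
      constructor <;> apply toPt_P <;> omega
  · have hp' := count_prev w p (by omega)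
    rcases hb : w.getD (p+1) true with _ | _ <;> rcases hb' : w.getD p true with _ | _
    all_goals
      have := hp' _ hb'
      simp only [chordAt, List.getD_cons_succ, List.getD_cons_zero, hb, hb', List.take_succ_cons,
        List.count_cons, Nat.add_sub_cancel]
      simp only [Nat.add_eq_zero_iff, one_ne_zero, and_false, false_or, ne_eq, not_true_eq_false,
        not_false_eq_true, if_true, if_false, reduceCtorEq, beq_self_eq_true, true_or,
        Bool.beq_eq_decide_eq, decide_true, decide_false, Bool.false_eq_true, Nat.cast_add,
        Nat.cast_one, Nat.cast_zero, add_zero, zero_add, or_true, or_self, Nat.sub_self,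
        List.getD_cons_zero]
      constructor <;> apply toPt_P <;> omega

lemma chord_M (w : List Bool) (p : ℕ) (hp : p < w.length) :
    toPt (w.length+1) (chordAt (false::w) (p+1)).1 = shf w.length (toPt w.length (chordAt w p).1) ∧
    toPt (w.length+1) (chordAt (false::w) (p+1)).2 =
      shf w.length (toPt w.length (chordAt w p).2) := by
  have hc := count_facts w p hp.le
  rcases p with _ | p
  · rcases hb : w.getD 0 true with _ | _
    all_goals
      simp only [chordAt, List.getD_cons_succ, List.getD_cons_zero, hb, List.take_succ_cons,
        List.count_cons, List.take_zero, List.count_nil]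
      simp only [Nat.add_eq_zero_iff, one_ne_zero, and_false, false_or, ne_eq, not_true_eq_false,
        not_false_eq_true, if_true, if_false, reduceCtorEq, beq_self_eq_true, true_or,
        Bool.beq_eq_decide_eq, decide_true, decide_false, Bool.false_eq_true, Nat.cast_add,
        Nat.cast_one, Nat.cast_zero, add_zero, zero_add, or_true, or_self, Nat.sub_self,
        List.getD_cons_zero]
      constructor <;> apply toPt_M <;> omega
  · have hp' := count_prev w p (by omega)
    rcases hb : w.getD (p+1) true with _ | _ <;> rcases hb' : w.getD p true with _ | _
    all_goals
      have := hp' _ hb'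
      simp only [chordAt, List.getD_cons_succ, List.getD_cons_zero, hb, hb', List.take_succ_cons,
        List.count_cons, Nat.add_sub_cancel]
      simp only [Nat.add_eq_zero_iff, one_ne_zero, and_false, false_or, ne_eq, not_true_eq_false,
        not_false_eq_true, if_true, if_false, reduceCtorEq, beq_self_eq_true, true_or,
        Bool.beq_eq_decide_eq, decide_true, decide_false, Bool.false_eq_true, Nat.cast_add,
        Nat.cast_one, Nat.cast_zero, add_zero, zero_add, or_true, or_self, Nat.sub_self,
        List.getD_cons_zero]
      constructor <;> apply toPt_M <;> omega

lemma final_P (w : List Bool) :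
    finalChord (true::w) = ((finalChord w).1 + 2, (finalChord w).2 + 2) := by
  rcases w with _ | ⟨b, t⟩
  · decide
  · have hc := count_facts (b::t) _ le_rfl
    rw [List.take_length] at hc
    have hl : (true::b::t).getLast? = (b::t).getLast? := List.getLast?_cons_cons
    unfold finalChord
    rw [hl]
    rcases h : (b::t).getLast? with _ | _ | _
    · simp at h
    · have hm : false ∈ b::t := List.mem_of_getLast? h
      have := List.count_pos_iff.2 hm
      simp only [List.length_cons (a := true), List.count_cons (a := true) (b := true), beq_self_eq_true, if_true]
      refine Prod.ext ?_ ?_ <;> simp only <;> apply toPt_P <;> push_cast <;> omega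
    · have hm : true ∈ b::t := List.mem_of_getLast? h
      have := List.count_pos_iff.2 hm
      simp only [List.length_cons (a := true), List.count_cons (a := true) (b := true), beq_self_eq_true, if_true]
      refine Prod.ext ?_ ?_ <;> simp only <;> apply toPt_P <;> push_cast <;> omega

lemma final_M (w : List Bool) (hw : w ≠ []) :
    finalChord (false::w) = (shf w.length (finalChord w).1, shf w.length (finalChord w).2) := by
  rcases w with _ | ⟨b, t⟩
  · exact absurd rfl hw
  · have hc := count_facts (b::t) _ le_rfl
    rw [List.take_length] at hc
    have hl : (false::b::t).getLast? = (b::t).getLast? := List.getLast?_cons_cons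
    unfold finalChord
    rw [hl]
    rcases h : (b::t).getLast? with _ | _ | _
    · simp at h
    · have hm : false ∈ b::t := List.mem_of_getLast? h
      have := List.count_pos_iff.2 hm
      simp only [List.length_cons (a := false), List.count_cons (a := true) (b := false), Bool.beq_eq_decide_eq, reduceCtorEq,
        decide_false, Bool.false_eq_true, if_false, add_zero]
      refine Prod.ext ?_ ?_ <;> simp only <;> apply toPt_M <;> push_cast <;> omega
    · have hm : true ∈ b::t := List.mem_of_getLast? h
      have := List.count_pos_iff.2 hm
      simp only [List.length_cons (a := false), List.count_cons (a := true) (b := false), Bool.beq_eq_decide_eq, reduceCtorEq,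
        decide_false, Bool.false_eq_true, if_false, add_zero]
      refine Prod.ext ?_ ?_ <;> simp only <;> apply toPt_M <;> push_cast <;> omega


lemma pairs_P (w : List Bool) :
    gammaPairs (true::w) = (0, 1) :: (gammaPairs w).map (fun p => (p.1+2, p.2+2)) := by
  unfold gammaPairs
  rw [List.length_cons, List.range_succ_eq_map, List.map_cons, List.map_map, List.map_append,
    List.map_map, List.cons_append, final_P]
  refine congrArg₂ List.cons ?_ ?_
  · have h1 : toPt (w.length+1) 0 = 0 := by rw [toPt_nonneg le_rfl (by omega)]; rfl
    have h2 : toPt (w.length+1) 1 = 1 := by rw [toPt_nonneg (by omega) (by push_cast; omega)]; rfl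
    simp [chordAt, h1, h2]
  · congr 1
    apply List.map_congr_left
    intro p hp
    have := chord_P w p (List.mem_range.1 hp)
    exact Prod.ext this.1 this.2

lemma pairs_M (w : List Bool) (hw : w ≠ []) :
    gammaPairs (false::w) = (2*w.length+3, 0) ::
      (gammaPairs w).map (fun p => (shf w.length p.1, shf w.length p.2)) := by
  unfold gammaPairs
  rw [List.length_cons, List.range_succ_eq_map, List.map_cons, List.map_map, List.map_append,
    List.map_map, List.cons_append, final_M w hw]
  refine congrArg₂ List.cons ?_ ?_
  · have h1 : toPt (w.length+1) 0 = 0 := by rw [toPt_nonneg le_rfl (by omega)]; rfl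
    have h2 : toPt (w.length+1) (-1) = 2*w.length+3 := by
      rw [toPt_neg (by push_cast; omega) (by omega)]; push_cast; omega
    simp [chordAt, h1, h2]
  · congr 1
    apply List.map_congr_left
    intro p hp
    have := chord_M w p (List.mem_range.1 hp)
    exact Prod.ext this.1 this.2

lemma pairs_lt (w : List Bool) : ∀ p ∈ gammaPairs w, p.1 < 2*w.length+2 ∧ p.2 < 2*w.length+2 := by
  intro p hp
  unfold gammaPairs at hp
  rw [List.mem_append, List.mem_map, List.mem_singleton] at hp
  rcases hp with ⟨k, _, rfl⟩ | rfl
  · exact ⟨toPt_lt _ _, toPt_lt _ _⟩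
  · unfold finalChord
    split
    · constructor <;> simp only <;> exact toPt_lt _ _
    · constructor <;> simp only <;> exact toPt_lt _ _
    · simp

/-- The lookup in a list of pairs. -/
def look (L : List (ℕ × ℕ)) (a : ℕ) : ℕ :=
  match L.find? (fun pr => pr.1 == a || pr.2 == a) with
  | some pr => if pr.1 = a then pr.2 else pr.1
  | none => a

lemma gamma_look (w : List Bool) (a : ℕ) : gammaWord w a = look (gammaPairs w) a := rfl

lemma look_nil (a : ℕ) : look [] a = a := rfl

lemma look_cons (x y : ℕ) (L : List (ℕ × ℕ)) (a : ℕ) :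
    look ((x, y) :: L) a = if x = a then y else if y = a then x else look L a := by
  unfold look
  rw [List.find?_cons]
  by_cases h1 : x = a
  · simp [h1]
  · by_cases h2 : y = a
    · simp [h1, h2]
    · have : (x == a || y == a) = false := by simp [h1, h2]
      simp only [this, if_neg h1, if_neg h2]

/-- Lookup in a relabelled list. -/
lemma look_map (φ : ℕ → ℕ) (L : List (ℕ × ℕ)) (a b : ℕ) (hb : φ a = b)
    (hL : ∀ p ∈ L, (φ p.1 = b ↔ p.1 = a) ∧ (φ p.2 = b ↔ p.2 = a)) :
    look (L.map (fun p => (φ p.1, φ p.2))) b = φ (look L a) := by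
  induction L with
  | nil => simp [look_nil, hb]
  | cons p L ih =>
    obtain ⟨x, y⟩ := p
    have h := hL (x, y) (by simp)
    have ih := ih (fun p hp => hL p (by simp [hp]))
    simp only at h
    rw [List.map_cons, look_cons, look_cons, ih]
    by_cases h1 : x = a
    · rw [if_pos h1, if_pos (h.1.2 h1)]
    · rw [if_neg h1, if_neg (fun h' => h1 (h.1.1 h'))]
      by_cases h2 : y = a
      · rw [if_pos h2, if_pos (h.2.2 h2)]
      · rw [if_neg h2, if_neg (fun h' => h2 (h.2.1 h'))]

lemma gamma_nil : gammaWord [] = insP id := by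
  funext a
  rw [gamma_look]
  have : gammaPairs [] = [(0, 1)] := by decide
  rw [this, look_cons, look_nil]
  unfold insP
  simp only [id]
  split_ifs <;> omega

lemma gamma_P (w : List Bool) : gammaWord (true::w) = insP (gammaWord w) := by
  funext a
  rw [gamma_look, pairs_P, look_cons]
  rcases a with _ | _ | k
  · simp [insP]
  · simp [insP]
  · rw [if_neg (by omega), if_neg (by omega), insP_add, gamma_look]
    exact look_map (fun x => x + 2) (gammaPairs w) k (k+2) rfl (by intro p _; omega)

lemma gamma_M (w : List Bool) : gammaWord (false::w) = insM w.length (gammaWord w) := by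
  by_cases hw : w = []
  · subst hw
    funext a
    have : gammaPairs [false] = [(3, 0), (1, 2)] := by decide
    rw [gamma_look, this, gamma_nil]
    simp only [look_cons, look_nil, insM, insP, shf, ro, id, List.length_nil]
    rcases a with _ | _ | _ | _ | k <;> simp
  · funext a
    rw [gamma_look, pairs_M w hw, look_cons]
    unfold insM
    by_cases h0 : a = 0
    · rw [if_neg (by omega), if_pos h0.symm, if_pos h0]
    · by_cases h1 : a = 2*w.length+3
      · rw [if_pos h1.symm, if_neg h0, if_pos h1]
      · rw [if_neg (by omega), if_neg (by omega), if_neg h0, if_neg h1, gamma_look]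
        apply look_map (shf w.length) (gammaPairs w) (ro w.length a) a
        · unfold shf ro; split_ifs <;> omega
        · intro p hp
          have := pairs_lt w p hp
          unfold shf ro
          split_ifs <;> omega

lemma cd_zero_id : IsCD 0 id := by
  refine ⟨⟨?_, ?_, ?_, ?_⟩, ?_⟩
  · intro i hi; omega
  · intro i hi; omega
  · intro i hi; omega
  · intro i _; rfl
  · intro a b ha; omega

lemma cd_gamma (w : List Bool) : IsCD (w.length+1) (gammaWord w) := by
  induction w with
  | nil => rw [gamma_nil]; exact cd_insP cd_zero_id
  | cons b w ih =>
    cases b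
    · rw [gamma_M]; exact cd_insM ih
    · rw [gamma_P]; exact cd_insP ih

lemma T_one (f : ℕ → ℕ) : T 0 1 f := by
  intro A h0 _ i hi he
  rw [Nat.even_iff] at he
  have : i = 0 := by omega
  rw [this]; exact h0

lemma len_eq (w : List Bool) : w.length = w.count true + w.count false := by
  have h := count_facts w _ le_rfl
  rw [List.take_length] at h
  omega

lemma T_gamma (w : List Bool) : T (w.count true) (w.length+1) (gammaWord w) := by
  induction w with
  | nil => exact T_one _
  | cons b w ih =>
    have := len_eq w
    cases b
    · rw [gamma_M]
      have e : (false::w).count true = w.count true := by simp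
      rw [List.length_cons, e]
      exact (T_insM (by omega) (cd_gamma w)).2 ih
    · rw [gamma_P]
      simp only [List.length_cons, List.count_cons]
      exact T_insP.2 ih

lemma T_basis (n : ℕ) : ∀ nm np f, nm + np = n → IsCD (nm+np+1) f → T np (nm+np+1) f →
    ∃ w, memW nm np w ∧ f = gammaWord w := by
  induction n with
  | zero =>
    intro nm np f h hf _
    obtain ⟨rfl, rfl⟩ : nm = 0 ∧ np = 0 := by omega
    refine ⟨[], by simp [memW], ?_⟩
    have h1 := hf.1.1 0 (by omega)
    have h2 := hf.1.2.2.1 0 (by omega)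
    obtain ⟨g, hg, rfl⟩ := insP_surj (n := 0) hf (by omega)
    rw [gamma_nil]
    congr 1
    funext i
    exact hg.1.2.2.2 i (by omega)
  | succ n ih =>
    intro nm np f h hf hT
    rcases T_zero (by omega) hf hT with h1 | ⟨h1, h2⟩ | ⟨h1, h2⟩
    · omega
    · obtain ⟨np, rfl⟩ : ∃ k, np = k+1 := ⟨np-1, by omega⟩
      obtain ⟨g, hg, rfl⟩ := insP_surj (n := nm+np+1) hf h1
      obtain ⟨w, hw, rfl⟩ := ih nm np g (by omega) hg (T_insP.1 hT)
      refine ⟨true::w, ?_, (gamma_P w).symm⟩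
      unfold memW at hw ⊢
      simp [hw.1, hw.2]
    · obtain ⟨nm, rfl⟩ : ∃ k, nm = k+1 := ⟨nm-1, by omega⟩
      have e : nm + 1 + np + 1 = (nm + np) + 2 := by omega
      rw [e] at hf hT h1
      obtain ⟨g, hg, rfl⟩ := insM_surj (m := nm+np) hf (by omega)
      obtain ⟨w, hw, rfl⟩ := ih nm np g (by omega) hg ((T_insM (by omega) hg).1 hT)
      have hl := len_eq w
      unfold memW at hw
      have hl' : w.length = nm + np := by omega
      refine ⟨false::w, ?_, ?_⟩
      · unfold memW
        simp [hw.1, hw.2]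
      · rw [gamma_M, hl']

open Classical in
/-- The value of the functional on a single diagram. -/
noncomputable def ph (np n : ℕ) (f : ℕ → ℕ) : ZMod 2 := if IsCD n f ∧ T np n f then 1 else 0

/-- The functional. -/
noncomputable def Ph (np n : ℕ) : ((ℕ → ℕ) →₀ ZMod 2) →ₗ[ZMod 2] ZMod 2 :=
  Finsupp.linearCombination (ZMod 2) (ph np n)

lemma Ph_single (np n : ℕ) (f : ℕ → ℕ) : Ph np n (Finsupp.single f 1) = ph np n f := by
  simp [Ph]

lemma Ph_le {np n : ℕ} (hn : np < n) : bypassSub n ≤ LinearMap.ker (Ph np n) := by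
  unfold bypassSub
  rw [Submodule.span_le]
  rintro x (⟨f, g, h, hb, rfl⟩ | ⟨f, hf, rfl⟩)
  · simp only [SetLike.mem_coe, LinearMap.mem_ker, map_add, Ph_single]
    exact bypass_sum hn hb
  · simp only [SetLike.mem_coe, LinearMap.mem_ker, Ph_single]
    simp [ph, hf]

lemma main (nm np : ℕ) (f : ℕ → ℕ)
    (hf : IsCD (nm+np+1) f)
    (hnb : ∀ w : List Bool, memW nm np w → f ≠ gammaWord w)
    (S : Finset (List Bool))
    (hS : ∀ w ∈ S, memW nm np w)
    (hdec : (bypassSub (nm+np+1)).mkQ (Finsupp.single f (1 : ZMod 2))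
      = ∑ w ∈ S, (bypassSub (nm+np+1)).mkQ (Finsupp.single (gammaWord w) (1 : ZMod 2))) :
    Even S.card := by
  have hle := Ph_le (np := np) (n := nm+np+1) (by omega)
  have h := congrArg ((bypassSub (nm+np+1)).liftQ _ hle) hdec
  simp only [map_sum, Submodule.mkQ_apply, Submodule.liftQ_apply, Ph_single] at h
  have h1 : ph np (nm+np+1) f = 0 := by
    unfold ph
    rw [if_neg]
    rintro ⟨_, hT⟩
    obtain ⟨w, hw, e⟩ := T_basis _ nm np f rfl hf hT
    exact hnb w hw e
  have h2 : ∀ w ∈ S, ph np (nm+np+1) (gammaWord w) = 1 := by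
    intro w hw
    have hl := len_eq w
    obtain ⟨a, b⟩ := hS w hw
    have hl' : nm + np + 1 = w.length + 1 := by omega
    unfold ph
    rw [if_pos]
    rw [hl', ← b]
    exact ⟨cd_gamma w, T_gamma w⟩
  rw [h1, Finset.sum_congr rfl h2, Finset.sum_const, nsmul_eq_mul, mul_one] at h
  exact (ZMod.natCast_eq_zero_iff_even).1 h.symm

end Aux16

/-- If a chord diagram of `n₋+n₊+1` chords and euler class `e = n₊-n₋` is not
itself a basis chord diagram, then any decomposition of its class (in the
`ℤ/2` space of chord diagrams modulo the bypass relation) as a sum of classes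
of basis chord diagrams `Γ_w`, `w ∈ W(n₋,n₊)`, has an even number of terms. -/
theorem stmt16 (nm np : ℕ) (f : ℕ → ℕ)
    (hf : IsCD (nm+np+1) f)
    (he : eulerClass (nm+np+1) f = (np : ℤ) - (nm : ℤ))
    (hnb : ∀ w : List Bool, memW nm np w → f ≠ gammaWord w)
    (S : Finset (List Bool))
    (hS : ∀ w ∈ S, memW nm np w)
    (hdec : (bypassSub (nm+np+1)).mkQ (Finsupp.single f (1 : ZMod 2))
      = ∑ w ∈ S, (bypassSub (nm+np+1)).mkQ (Finsupp.single (gammaWord w) (1 : ZMod 2))) :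
    Even S.card := by
  exact Aux16.main nm np f hf hnb S hS hdec
end
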